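/- arXiv:1701.01483 — 2 statements merged into one kernel-verified Lean document; each statement's English description precedes it below -/
import Mathlib

section
/- Fix t > 0 and ε > 0. Let f: ℝⁿ → [k] be a degree-d, (d,ε)-balanced multivariate PTF with E[f] = μ and Pr[x ∈ Collision(f)] ≤ ε/(40k²). Then there is an explicitly computable n₀ = n₀(d,k,ε) and a degree-d multivariate PTF f_junta: ℝ^{n₀} → [k] such that ‖E[f_junta] − μ‖₁ ≤ ε and E[⟨f_junta, P_t f_junta⟩] ≥ E[⟨f, P_t f⟩] − ε. -/
open MeasureTheory ProbabilityTheory MvPolynomial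
open scoped Classical

noncomputable section

namespace GaussNS

/-- The standard Gaussian measure `γ` on `ι → ℝ`. -/
def gaussianPi (ι : Type*) [Fintype ι] : Measure (ι → ℝ) :=
  Measure.pi fun _ => gaussianReal 0 1

/-- `Fin k` embedded as the standard basis vectors `e₁, …, e_k` of `ℝᵏ`. -/
def basisVec {k : ℕ} (i : Fin k) : Fin k → ℝ := fun j => if j = i then 1 else 0

/-- The Ornstein–Uhlenbeck operator `P_t` acting on scalar functions:
`(P_t f)(x) = ∫ f(e^{-t} x + √(1-e^{-2t}) y) dγ(y)`. -/
def ouOp {ι : Type*} [Fintype ι] (t : ℝ) (f : (ι → ℝ) → ℝ) (x : ι → ℝ) : ℝ :=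
  ∫ y, f (fun i => Real.exp (-t) * x i + Real.sqrt (1 - Real.exp (-2 * t)) * y i) ∂gaussianPi ι

/-- Noise stability `E⟨f, P_t f⟩` of a `[k]`-valued function on Gaussian space,
where `f` is identified with a basis-vector-valued function. -/
def noiseStab {ι : Type*} [Fintype ι] {k : ℕ} (t : ℝ) (f : (ι → ℝ) → Fin k) : ℝ :=
  ∫ x, ∑ j, basisVec (f x) j * ouOp t (fun y => basisVec (f y) j) x ∂gaussianPi ι

/-- The mean vector `E[f] ∈ Δ_k` of a `[k]`-valued function. -/
def gMean {ι : Type*} [Fintype ι] {k : ℕ} (f : (ι → ℝ) → Fin k) : Fin k → ℝ :=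
  fun j => ∫ x, basisVec (f x) j ∂gaussianPi ι

/-- The multivariate polynomial threshold function `PTF(p₁,…,p_k)`: value `j` if
`p j > 0` and `p i ≤ 0` for all `i ≠ j`, and the first index otherwise. -/
def ptf {ι : Type*} {k : ℕ} [NeZero k] (p : Fin k → MvPolynomial ι ℝ) (x : ι → ℝ) : Fin k :=
  if h : ∃ j, 0 < eval x (p j) ∧ ∀ i, i ≠ j → eval x (p i) ≤ 0 then h.choose else 0

/-- Collision set of a multivariate PTF: points where the number of strictly
positive `p j` is not exactly one. -/
def collisionSet {ι : Type*} {k : ℕ} (p : Fin k → MvPolynomial ι ℝ) : Set (ι → ℝ) :=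
  {x | ¬ ∃! j, 0 < eval x (p j)}

/-- Gaussian expectation of a polynomial. -/
def gExp {ι : Type*} [Fintype ι] (p : MvPolynomial ι ℝ) : ℝ :=
  ∫ x, eval x p ∂gaussianPi ι

/-- Gaussian variance of a polynomial. -/
def gVar {ι : Type*} [Fintype ι] (p : MvPolynomial ι ℝ) : ℝ :=
  (∫ x, (eval x p) ^ 2 ∂gaussianPi ι) - gExp p ^ 2

/-- A family `p₁,…,p_k` of polynomials is `(d, δ)`-balanced if each `p i` has Gaussian
variance `1` and `|E[p i]| ≤ (log (k d / δ))^{d/2}`. -/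
def balancedFam {ι : Type*} [Fintype ι] {k : ℕ} (d : ℕ) (δ : ℝ)
    (p : Fin k → MvPolynomial ι ℝ) : Prop :=
  ∀ i, gVar (p i) = 1 ∧ |gExp (p i)| ≤ Real.log ((k : ℝ) * d / δ) ^ ((d : ℝ) / 2)

/-- The normalized multivariate Hermite polynomial `H_S(x) = ∏ i, H_{S i}(x i)/√(S i)!`. -/
def hermiteH {ι : Type*} [Fintype ι] (S : ι → ℕ) (x : ι → ℝ) : ℝ :=
  ∏ i, (Polynomial.aeval (x i) (Polynomial.hermite (S i)) / Real.sqrt (Nat.factorial (S i)))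

/-- The Hermite coefficient `f̂(S) = E[f · H_S]`. -/
def hermCoeff {ι : Type*} [Fintype ι] (f : (ι → ℝ) → ℝ) (S : ι → ℕ) : ℝ :=
  ∫ x, f x * hermiteH S x ∂gaussianPi ι

/-- Hermite weight `W^{>d}[f] = Σ_{|S| > d} ‖f̂(S)‖²` of a vector-valued function. -/
def wAbove {ι : Type*} [Fintype ι] {k : ℕ} (d : ℕ) (f : (ι → ℝ) → Fin k → ℝ) : ℝ :=
  ∑' S : ι → ℕ, if d < ∑ i, S i then ∑ j, hermCoeff (fun x => f x j) S ^ 2 else 0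

/-- Hermite weight `W^{≥d}[f] = Σ_{|S| ≥ d} f̂(S)²` of a scalar function. -/
def wGE {ι : Type*} [Fintype ι] (d : ℕ) (f : (ι → ℝ) → ℝ) : ℝ :=
  ∑' S : ι → ℕ, if d ≤ ∑ i, S i then hermCoeff f S ^ 2 else 0

/-- Squared `L²(γ)` norm `Σ_{|S| = q} f̂(S)²` of the projection of `f` onto
the `q`-th Wiener chaos. -/
def chaosNormSq {ι : Type*} [Fintype ι] (q : ℕ) (f : (ι → ℝ) → ℝ) : ℝ :=
  ∑' S : ι → ℕ, if (∑ i, S i) = q then hermCoeff f S ^ 2 else 0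

/-- Frobenius norm of a tensor. -/
def frobNorm {α ι : Type*} [Fintype α] [Fintype ι] (T : (α → ι) → ℝ) : ℝ :=
  Real.sqrt (∑ t, T t ^ 2)

/-- Contraction product `f ⊗_r g` of an order-`p` and an order-`q` tensor along `r`
indices, presented as a tensor in the remaining `(p-r)` and `(q-r)` indices. -/
def contr {ι : Type*} [Fintype ι] {p q r : ℕ} (hp : r ≤ p) (hq : r ≤ q)
    (f : (Fin p → ι) → ℝ) (g : (Fin q → ι) → ℝ)
    (a : Fin (p - r) → ι) (b : Fin (q - r) → ι) : ℝ :=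
  ∑ z : Fin r → ι,
    f (fun i => Fin.append a z (Fin.cast (Nat.sub_add_cancel hp).symm i)) *
      g (fun i => Fin.append b z (Fin.cast (Nat.sub_add_cancel hq).symm i))

/-- `λ_{S,S̄}(A)`: the largest singular value of the matricization of `A` along the
partition `(S, S̄)` of its index set. -/
def lamPart {ι : Type*} [Fintype ι] {q : ℕ} (A : (Fin q → ι) → ℝ) (S : Finset (Fin q)) : ℝ :=
  ⨆ g : ({i // i ∈ S} → ι) → ℝ, ⨆ h : ({i // i ∉ S} → ι) → ℝ,
    (∑ t : Fin q → ι, A t * g (fun i => t i.1) * h (fun i => t i.1)) /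
      (frobNorm g * frobNorm h)

/-- `λ_max(A)`: maximum of `λ_{S,S̄}(A)` over nontrivial partitions `(S, S̄)`. -/
def lamMax {ι : Type*} [Fintype ι] {q : ℕ} (A : (Fin q → ι) → ℝ) : ℝ :=
  ⨆ S : {S : Finset (Fin q) // S ≠ ∅ ∧ S ≠ Finset.univ}, lamPart A S.1

/-- The symmetric tensor `A_q` with `p = Σ_q I_q(A_q)` for a multilinear polynomial
(in terms of its Hermite coefficients). -/
def chaosTensor {ι : Type*} [Fintype ι] [DecidableEq ι] (f : (ι → ℝ) → ℝ) (q : ℕ) :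
    (Fin q → ι) → ℝ :=
  fun t => if Function.Injective t then
      hermCoeff f (fun i => (Finset.univ.filter fun j => t j = i).card) / Real.sqrt (Nat.factorial q)
    else 0

/-- `λ_max(p) = max_{2 ≤ q ≤ deg p} λ_max(A_q)`. -/
def polyLamMax {ι : Type*} [Fintype ι] [DecidableEq ι] (p : MvPolynomial ι ℝ) : ℝ :=
  ⨆ q : {q : ℕ // 2 ≤ q ∧ q ≤ p.totalDegree}, lamMax (chaosTensor (fun x => eval x p) q.1)

/-- A polynomial is `δ`-eigenregular if `λ_max(p) ≤ δ √(Var p)`. -/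
def eigenregular {ι : Type*} [Fintype ι] [DecidableEq ι] (δ : ℝ) (p : MvPolynomial ι ℝ) : Prop :=
  polyLamMax p ≤ δ * Real.sqrt (gVar p)

/-- `p` lies in the `j`-th Wiener chaos `W^j`. -/
def inChaos {ι : Type*} [Fintype ι] (j : ℕ) (p : MvPolynomial ι ℝ) : Prop :=
  ∀ S : ι → ℕ, (∑ i, S i) ≠ j → hermCoeff (fun x => eval x p) S = 0

/-- Expectation over the uniform measure on the hypercube `{-1,1}ⁿ ≃ Boolⁿ`. -/
def cubeE {n : ℕ} (g : (Fin n → Bool) → ℝ) : ℝ := (∑ x, g x) / 2 ^ n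

/-- The Bonami–Beckner operator `T_ρ` on the hypercube. -/
def bbOp {n : ℕ} (ρ : ℝ) (g : (Fin n → Bool) → ℝ) (x : Fin n → Bool) : ℝ :=
  ∑ y : Fin n → Bool, (∏ i, if y i = x i then (1 + ρ) / 2 else (1 - ρ) / 2) * g y

/-- Noise stability `E⟨f, T_ρ f⟩` on the hypercube of a `[k]`-valued function. -/
def cubeStab {n k : ℕ} (ρ : ℝ) (f : (Fin n → Bool) → Fin k) : ℝ :=
  cubeE fun x => ∑ j, basisVec (f x) j * bbOp ρ (fun y => basisVec (f y) j) x

/-- Influence of coordinate `i`: `Inf_i(f) = E_z[Var(f_{z,-i})]`, computed as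
`E_x[‖f(x) - f(x^{⊕i})‖² / 4]`. -/
def influence {n k : ℕ} (i : Fin n) (f : (Fin n → Bool) → Fin k → ℝ) : ℝ :=
  cubeE fun x => (∑ j, (f x j - f (Function.update x i (!(x i))) j) ^ 2) / 4

/-- `g ∈ T_z(F)`: `g` is a measurable rounding of `F` by thresholding at `z`, i.e.
`⟨e_{g(x)}, F(x) - z⟩ ≥ F_i(x) - z_i` for all `i` and `x`. -/
def memTz {ι : Type*} [Fintype ι] {k : ℕ} (z : Fin k → ℝ) (F : (ι → ℝ) → Fin k → ℝ)
    (g : (ι → ℝ) → Fin k) : Prop :=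
  Measurable (fun x => basisVec (g x)) ∧ ∀ x i, F x i - z i ≤ F x (g x) - z (g x)

/-- `V` bounds the Gaussian total variation `E[|∇f|]` of `f`, characterized
distributionally: for every `C¹` compactly supported vector field `φ` with `‖φ‖ ≤ 1`,
`∫ f · (div φ - ⟨x, φ⟩) dγ ≤ V`.  The least such `V` is `E[|∇f|]`. -/
def gaussTV {n : ℕ} (f : (Fin n → ℝ) → ℝ) (V : ℝ) : Prop :=
  ∀ φ : (Fin n → ℝ) → (Fin n → ℝ), ContDiff ℝ 1 φ → HasCompactSupport φ →
    (∀ x, Real.sqrt (∑ i, φ x i ^ 2) ≤ 1) →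
    (∫ x, f x * ((∑ i, fderiv ℝ (fun y => φ y i) x (Pi.single i 1)) - ∑ i, x i * φ x i)
        ∂gaussianPi (Fin n)) ≤ V

/-- Evaluation of a polynomial at the noisy point `e^{-t} x + √(1-e^{-2t}) y`. -/
def corrEval {m : ℕ} (t : ℝ) (p : MvPolynomial (Fin m) ℝ)
    (xy : (Fin m → ℝ) × (Fin m → ℝ)) : ℝ :=
  eval (fun i => Real.exp (-t) * xy.1 i + Real.sqrt (1 - Real.exp (-2 * t)) * xy.2 i) p

end GaussNS

open GaussNS

namespace GaussNS

/-- The selection rule of a multivariate PTF, as a function of the values of the polynomials. -/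
def ptfSel {k : ℕ} [NeZero k] (v : Fin k → ℝ) : Fin k :=
  if h : ∃ j, 0 < v j ∧ ∀ i, i ≠ j → v i ≤ 0 then h.choose else 0

lemma ptf_eq_ptfSel {ι : Type*} {k : ℕ} [NeZero k] (p : Fin k → MvPolynomial ι ℝ) (x : ι → ℝ) :
    ptf p x = ptfSel fun j => eval x (p j) := rfl

lemma ptfSel_congr {k : ℕ} [NeZero k] {v w : Fin k → ℝ} (h : ∀ j, 0 < v j ↔ 0 < w j) :
    ptfSel v = ptfSel w := by
  have key : (fun j => 0 < v j ∧ ∀ i, i ≠ j → v i ≤ 0) =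
      fun j => 0 < w j ∧ ∀ i, i ≠ j → w i ≤ 0 := by
    funext j
    simp only [← not_lt, h]
  unfold ptfSel
  simp only [key]

lemma measurable_ptfSel {k : ℕ} [NeZero k] : Measurable (ptfSel (k := k)) := by
  have h : (ptfSel (k := k)) =
      (fun s : Fin k → Bool => ptfSel fun j => if s j then 1 else 0) ∘
        fun v j => decide (0 < v j) := by
    funext v
    refine ptfSel_congr fun j => ?_
    by_cases hj : 0 < v j <;> simp [hj]
  rw [h]
  refine (Measurable.of_discrete).comp (measurable_pi_lambda _ fun j => ?_)
  have hj : MeasurableSet {v : Fin k → ℝ | 0 < v j} :=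
    measurableSet_lt measurable_const (measurable_pi_apply j)
  exact measurable_to_bool (by simpa [Set.preimage] using hj)

lemma measurable_ptf {n k : ℕ} [NeZero k] (p : Fin k → MvPolynomial (Fin n) ℝ) :
    Measurable (ptf p) :=
  measurable_ptfSel.comp
    (measurable_pi_lambda _ fun j => (MvPolynomial.continuous_eval (p j)).measurable)

/-- Evaluation of `p` at `v`, where the monomial of degree `e` receives the extra weight
`W (d - e)`. -/
def weightedAeval {n : ℕ} {A : Type*} [CommRing A] [Algebra ℝ A] (d : ℕ)
    (p : MvPolynomial (Fin n) ℝ) (W : ℕ → A) (v : Fin n → A) : A :=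
  ∑ m ∈ p.support, algebraMap ℝ A (coeff m p) * (W (d - ∑ i, m i) * ∏ i, v i ^ m i)

lemma map_weightedAeval {n : ℕ} {A B : Type*} [CommRing A] [Algebra ℝ A] [CommRing B]
    [Algebra ℝ B] (φ : A →ₐ[ℝ] B) (d : ℕ) (p : MvPolynomial (Fin n) ℝ) (W : ℕ → A)
    (v : Fin n → A) :
    φ (weightedAeval d p W v) = weightedAeval d p (fun e => φ (W e)) fun i => φ (v i) := by
  simp [weightedAeval, map_sum, map_prod]

lemma sum_le_of_mem_support {n d : ℕ} {p : MvPolynomial (Fin n) ℝ} (hp : p.totalDegree ≤ d)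
    {m : Fin n →₀ ℕ} (hm : m ∈ p.support) : ∑ i, m i ≤ d := by
  have := le_totalDegree hm
  rw [Finsupp.sum_fintype _ _ (by simp)] at this
  exact this.trans hp

lemma natDegree_weightedAeval_le {n d : ℕ} {p : MvPolynomial (Fin n) ℝ}
    (hp : p.totalDegree ≤ d) {W : ℕ → Polynomial ℝ} {v : Fin n → Polynomial ℝ}
    (hW : ∀ e, (W e).natDegree ≤ 2 * e) (hv : ∀ i, (v i).natDegree ≤ 2) :
    (weightedAeval d p W v).natDegree ≤ 2 * d := by
  refine Polynomial.natDegree_sum_le_of_forall_le _ _ fun m hm => ?_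
  have hmd := sum_le_of_mem_support hp hm
  refine (Polynomial.natDegree_C_mul_le _ _).trans (Polynomial.natDegree_mul_le.trans ?_)
  have h1 : (∏ i, v i ^ m i).natDegree ≤ ∑ i, 2 * m i := by
    refine (Polynomial.natDegree_prod_le _ _).trans (Finset.sum_le_sum fun i _ => ?_)
    refine Polynomial.natDegree_pow_le.trans ?_
    rw [mul_comm]
    exact Nat.mul_le_mul_right _ (hv i)
  rw [← Finset.mul_sum] at h1
  have := hW (d - ∑ i, m i)
  omega

lemma totalDegree_weightedAeval_le {n d : ℕ} {σ : Type*} {p : MvPolynomial (Fin n) ℝ}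
    (hp : p.totalDegree ≤ d) {W : ℕ → MvPolynomial σ ℝ} {v : Fin n → MvPolynomial σ ℝ}
    (hW : ∀ e, (W e).totalDegree ≤ e) (hv : ∀ i, (v i).totalDegree ≤ 1) :
    (weightedAeval d p W v).totalDegree ≤ d := by
  refine totalDegree_finsetSum_le fun m hm => ?_
  have hmd := sum_le_of_mem_support hp hm
  refine (totalDegree_mul _ _).trans ?_
  have h0 : (algebraMap ℝ (MvPolynomial σ ℝ) (coeff m p)).totalDegree = 0 := totalDegree_C _
  have h1 : (∏ i, v i ^ m i).totalDegree ≤ ∑ i, m i := by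
    refine (totalDegree_finsetProd _ _).trans (Finset.sum_le_sum fun i _ => ?_)
    refine (totalDegree_pow _ _).trans ?_
    simpa using Nat.mul_le_mul_left (m i) (hv i)
  have h2 := totalDegree_mul (W (d - ∑ i, m i)) (∏ i, v i ^ m i)
  have := hW (d - ∑ i, m i)
  omega

lemma weightedAeval_pow {n d : ℕ} {p : MvPolynomial (Fin n) ℝ} (hp : p.totalDegree ≤ d)
    (r : ℝ) (z : Fin n → ℝ) :
    weightedAeval d p (fun e => r ^ e) (fun i => r * z i) = r ^ d * eval z p := by
  rw [eval_eq', weightedAeval, Finset.mul_sum]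
  refine Finset.sum_congr rfl fun m hm => ?_
  have hmd := sum_le_of_mem_support hp hm
  simp only [mul_pow, Finset.prod_mul_distrib, Finset.prod_pow_eq_pow_sum]
  rw [← Nat.sub_add_cancel hmd, pow_add, Nat.add_sub_cancel]
  simp only [Algebra.algebraMap_self, RingHom.id_apply]
  ring

lemma weightedAeval_parity {n d : ℕ} {p : MvPolynomial (Fin n) ℝ} (hp : p.totalDegree ≤ d)
    (r c : ℝ) (z : Fin n → ℝ) :
    weightedAeval d p (fun e => (r ^ 2) ^ (e / 2) * (c * r) ^ (e % 2)) (fun i => r * z i) =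
      r ^ d * ((1 + c) / 2 * eval z p + (1 - c) / 2 * ((-1) ^ d * eval (-z) p)) := by
  rw [eval_eq', eval_eq', weightedAeval]
  simp only [Finset.mul_sum, ← Finset.sum_add_distrib]
  refine Finset.sum_congr rfl fun m hm => ?_
  have hmd := sum_le_of_mem_support hp hm
  simp only [mul_pow, Finset.prod_mul_distrib, Finset.prod_pow_eq_pow_sum, Pi.neg_apply]
  simp only [neg_pow (z _), Finset.prod_mul_distrib, Finset.prod_pow_eq_pow_sum]
  obtain ⟨e, rfl⟩ := Nat.exists_eq_add_of_le hmd
  have hsq : ((-1 : ℝ) ^ (∑ i, m i)) * (-1) ^ (∑ i, m i) = 1 := by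
    rw [← mul_pow]; simp
  simp only [Algebra.algebraMap_self, RingHom.id_apply, Nat.add_sub_cancel_left, ← pow_mul,
    pow_add]
  have key : r ^ (2 * (e / 2)) * (c ^ (e % 2) * r ^ (e % 2)) =
      r ^ e * ((1 + c) / 2 + (1 - c) / 2 * (-1) ^ e) := by
    rcases Nat.even_or_odd' e with ⟨q, rfl | rfl⟩
    · simp [pow_mul]; ring
    · have h1 : (2 * q + 1) / 2 = q := by omega
      have h2 : (2 * q + 1) % 2 = 1 := by omega
      rw [h1, h2]
      simp [pow_mul, pow_succ]; ring
  rw [key]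
  linear_combination (-(coeff m p) * r ^ e * r ^ (∑ i, m i) * (∏ i, z i ^ m i) * ((1 - c) / 2) *
    (-1) ^ e) * hsq

/-- The point at angle `φ` of the ellipse through `x` and `y` centred at the origin. -/
def circ {n : ℕ} (φ : ℝ) (xy : (Fin n → ℝ) × (Fin n → ℝ)) : Fin n → ℝ :=
  Real.cos φ • xy.1 + Real.sin φ • xy.2

lemma circ_zero {n : ℕ} (xy : (Fin n → ℝ) × (Fin n → ℝ)) : circ 0 xy = xy.1 := by
  simp [circ]

lemma circ_sub_pi {n : ℕ} (φ : ℝ) (xy : (Fin n → ℝ) × (Fin n → ℝ)) :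
    circ (φ - Real.pi) xy = -circ φ xy := by
  simp [circ, Real.cos_sub_pi, Real.sin_sub_pi, add_comm]

lemma continuous_circ {n : ℕ} :
    Continuous fun q : ℝ × ((Fin n → ℝ) × (Fin n → ℝ)) => circ q.1 q.2 := by
  unfold circ
  fun_prop

lemma measurable_circ {n : ℕ} (φ : ℝ) : Measurable (circ (n := n) φ) :=
  (continuous_circ.comp (by fun_prop : Continuous fun xy => (φ, xy))).measurable

/-- Along the ellipse a polynomial is, up to a positive factor, a univariate polynomial in the
tangent of the half angle. -/
lemma exists_circlePoly {n d : ℕ} {p : MvPolynomial (Fin n) ℝ} (hp : p.totalDegree ≤ d)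
    (xy : (Fin n → ℝ) × (Fin n → ℝ)) :
    ∃ R : Polynomial ℝ, R.natDegree ≤ 2 * d ∧ ∀ φ : ℝ, Real.cos (φ / 2) ≠ 0 →
      R.eval (Real.tan (φ / 2)) =
        (1 + Real.tan (φ / 2) ^ 2) ^ d * eval (circ φ xy) p := by
  refine ⟨weightedAeval d p (fun e => (1 + Polynomial.X ^ 2) ^ e) (fun i =>
    (1 - Polynomial.X ^ 2) * Polynomial.C (xy.1 i) +
      Polynomial.C 2 * Polynomial.X * Polynomial.C (xy.2 i)), ?_, fun φ hφ => ?_⟩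
  · refine natDegree_weightedAeval_le hp (fun e => ?_) fun i => ?_
    · refine Polynomial.natDegree_pow_le.trans ?_
      rw [mul_comm]
      refine Nat.mul_le_mul_right _ ?_
      compute_degree
    · compute_degree
  · rw [← Polynomial.coe_aeval_eq_eval]
    rw [map_weightedAeval]
    have h := weightedAeval_pow hp (1 + Real.tan (φ / 2) ^ 2) (circ φ xy)
    rw [← h]
    congr 1
    · funext e
      simp
    · funext i
      have hc : Real.cos φ = 2 * Real.cos (φ / 2) ^ 2 - 1 := by
        rw [← Real.cos_two_mul]; congr 1; ring
      have hs : Real.sin φ = 2 * Real.sin (φ / 2) * Real.cos (φ / 2) := by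
        rw [← Real.sin_two_mul]; congr 1; ring
      have hsq := Real.sin_sq_add_cos_sq (φ / 2)
      simp only [circ, Pi.add_apply, Pi.smul_apply, smul_eq_mul, hc, hs, Real.tan_eq_sin_div_cos]
      simp
      field_simp
      linear_combination (-2 * xy.1 i * Real.cos (φ / 2) ^ 2
        - 2 * xy.2 i * Real.sin (φ / 2) * Real.cos (φ / 2)) * hsq

/-- A polynomial that is small at more than `deg` nodes is small at any given point; quantitative
form along the ellipse, comparing antipodal points. -/
lemma exists_card_smallBall_le (d K : ℕ) (φ : Fin K → ℝ) (hφ : Function.Injective φ)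
    (hφ0 : ∀ i, φ i ∈ Set.Ioo 0 Real.pi) :
    ∃ η : ℝ, 0 < η ∧ ∀ (n : ℕ) (p : MvPolynomial (Fin n) ℝ), p.totalDegree ≤ d →
      ∀ xy : (Fin n → ℝ) × (Fin n → ℝ),
        (Finset.univ.filter fun i : Fin K => |eval (circ (φ i) xy) p| ≤
          η * |eval (-circ (φ i) xy) p| ∧ eval (-circ (φ i) xy) p ≠ 0).card ≤ 2 * d := by
  set s : Fin K → ℝ := fun i => Real.tan (φ i / 2) with hs
  set s' : Fin K → ℝ := fun i => Real.tan ((φ i - Real.pi) / 2) with hs'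
  have hpi := Real.pi_pos
  have hcos : ∀ i, Real.cos (φ i / 2) ≠ 0 := fun i =>
    (Real.cos_pos_of_mem_Ioo ⟨by linarith [(hφ0 i).1], by linarith [(hφ0 i).2]⟩).ne'
  have hcos' : ∀ i, Real.cos ((φ i - Real.pi) / 2) ≠ 0 := fun i =>
    (Real.cos_pos_of_mem_Ioo ⟨by linarith [(hφ0 i).1], by linarith [(hφ0 i).2]⟩).ne'
  have hsinj : Function.Injective s := fun i j hij => hφ <| by
    have := Real.injOn_tan (x₁ := φ i / 2) (x₂ := φ j / 2)
      ⟨by linarith [(hφ0 i).1], by linarith [(hφ0 i).2]⟩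
      ⟨by linarith [(hφ0 j).1], by linarith [(hφ0 j).2]⟩ hij
    linarith
  set c : Finset (Fin K) → Fin K → Fin K → ℝ := fun T i j =>
    |(Lagrange.basis T s i).eval (s' j)| * (1 + s i ^ 2) ^ d with hc
  have hc0 : ∀ T i j, 0 ≤ c T i j := fun T i j => by positivity
  set C : ℝ := ∑ T : Finset (Fin K), ∑ j : Fin K, ∑ i : Fin K, c T i j with hC
  have hC0 : 0 ≤ C := Finset.sum_nonneg fun T _ => Finset.sum_nonneg fun j _ =>
    Finset.sum_nonneg fun i _ => hc0 T i j
  have hcC : ∀ T j, ∑ i, c T i j ≤ C := fun T j =>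
    (Finset.single_le_sum (f := fun j => ∑ i, c T i j)
      (fun j _ => Finset.sum_nonneg fun i _ => hc0 T i j) (Finset.mem_univ j)).trans
    (Finset.single_le_sum (f := fun T => ∑ j, ∑ i, c T i j)
      (fun T _ => Finset.sum_nonneg fun j _ => Finset.sum_nonneg fun i _ => hc0 T i j)
      (Finset.mem_univ T))
  clear_value C
  have hCinv : 0 ≤ 1 / (C + 1) := by positivity
  refine ⟨1 / (C + 1), by positivity, fun n p hp xy => ?_⟩
  by_contra! hcard
  obtain ⟨T, hTsub, hT⟩ := Finset.exists_subset_card_eq (Nat.succ_le_of_lt hcard)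
  have hTne : T.Nonempty := Finset.card_pos.mp (by omega)
  obtain ⟨R, hRdeg, hR⟩ := exists_circlePoly hp xy
  obtain ⟨j, hjT, hjmax⟩ := T.exists_max_image (fun i => |eval (-circ (φ i) xy) p|) hTne
  set m := |eval (-circ (φ j) xy) p| with hm
  have hTmem : ∀ i ∈ T, |eval (circ (φ i) xy) p| ≤ 1 / (C + 1) * |eval (-circ (φ i) xy) p| ∧
      eval (-circ (φ i) xy) p ≠ 0 := fun i hi => (Finset.mem_filter.mp (hTsub hi)).2
  have hmpos : 0 < m := abs_pos.mpr (hTmem j hjT).2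
  have hRs : ∀ i, R.eval (s i) = (1 + s i ^ 2) ^ d * eval (circ (φ i) xy) p :=
    fun i => hR _ (hcos i)
  have hRs' : R.eval (s' j) = (1 + s' j ^ 2) ^ d * eval (-circ (φ j) xy) p := by
    rw [← circ_sub_pi]
    exact hR _ (hcos' j)
  have hpow : ∀ x : ℝ, 0 ≤ (1 + x ^ 2) ^ d := fun x => by positivity
  have hlow : m ≤ |R.eval (s' j)| := by
    rw [hRs', abs_mul, abs_of_nonneg (hpow _)]
    exact le_mul_of_one_le_left hmpos.le (one_le_pow₀ (by nlinarith [sq_nonneg (s' j)]))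
  have hinterp : R.eval (s' j) = ∑ i ∈ T, R.eval (s i) * (Lagrange.basis T s i).eval (s' j) := by
    have hdeg : R.degree < T.card := by
      refine (Polynomial.degree_le_natDegree).trans_lt ?_
      rw [hT]
      exact_mod_cast Nat.lt_succ_of_le hRdeg
    conv_lhs => rw [Lagrange.eq_interpolate hsinj.injOn hdeg]
    simp [Lagrange.interpolate_apply, Polynomial.eval_finsetSum]
  have hup : |R.eval (s' j)| ≤ 1 / (C + 1) * m * C := by
    rw [hinterp]
    calc |∑ i ∈ T, R.eval (s i) * (Lagrange.basis T s i).eval (s' j)|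
        ≤ ∑ i ∈ T, 1 / (C + 1) * m * c T i j := by
          refine (Finset.abs_sum_le_sum_abs _ _).trans (Finset.sum_le_sum fun i hi => ?_)
          rw [hRs, abs_mul, abs_mul, abs_of_nonneg (hpow (s i))]
          have h1 : |eval (circ (φ i) xy) p| ≤ 1 / (C + 1) * m :=
            (hTmem i hi).1.trans (mul_le_mul_of_nonneg_left (hjmax i hi) hCinv)
          calc _ = |eval (circ (φ i) xy) p| * c T i j := by simp only [hc]; ring
            _ ≤ _ := mul_le_mul_of_nonneg_right h1 (hc0 _ _ _)
      _ = 1 / (C + 1) * m * ∑ i ∈ T, c T i j := by rw [Finset.mul_sum]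
      _ ≤ 1 / (C + 1) * m * C := by
          refine mul_le_mul_of_nonneg_left ?_ (mul_nonneg hCinv hmpos.le)
          exact (Finset.sum_le_sum_of_subset_of_nonneg (Finset.subset_univ _)
            fun i _ _ => hc0 T i j).trans (hcC T j)
  have : 1 / (C + 1) * m * C < m := by
    rw [one_div, inv_mul_eq_div, div_mul_eq_mul_div, div_lt_iff₀ (by positivity)]
    nlinarith
  linarith

/-- A polynomial changes from positive to nonpositive at most `2 d` times along an arithmetic
progression of angles in a half circle. -/
lemma card_signChange_le {n d K : ℕ} {p : MvPolynomial (Fin n) ℝ} (hp : p.totalDegree ≤ d)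
    {ψ : ℝ} (hψ : 0 ≤ ψ) (hKψ : K * ψ < Real.pi) (xy : (Fin n → ℝ) × (Fin n → ℝ)) :
    (Finset.univ.filter fun i : Fin K => 0 < eval (circ (i * ψ) xy) p ∧
      ¬ 0 < eval (circ ((i + 1) * ψ) xy) p).card ≤ 2 * d := by
  obtain ⟨R, hRdeg, hR⟩ := exists_circlePoly hp xy
  have hpi := Real.pi_pos
  have hrange : ∀ i : ℕ, i ≤ K → (i : ℝ) * ψ / 2 ∈ Set.Ioo (-(Real.pi / 2)) (Real.pi / 2) := by
    intro i hi
    have h1 : (i : ℝ) * ψ ≤ K * ψ := mul_le_mul_of_nonneg_right (by exact_mod_cast hi) hψ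
    have h2 : 0 ≤ (i : ℝ) * ψ := by positivity
    constructor <;> linarith
  set s : ℕ → ℝ := fun i => Real.tan (i * ψ / 2) with hs
  have hsmono : ∀ i j : ℕ, i ≤ j → j ≤ K → s i ≤ s j := fun i j hij hj =>
    Real.strictMonoOn_tan.monotoneOn (hrange i (hij.trans hj)) (hrange j hj) (by gcongr)
  have hval : ∀ i : ℕ, i ≤ K → R.eval (s i) = (1 + s i ^ 2) ^ d * eval (circ (i * ψ) xy) p :=
    fun i hi => hR _ (Real.cos_pos_of_mem_Ioo (hrange i hi)).ne'
  set B := Finset.univ.filter fun i : Fin K => 0 < eval (circ (i * ψ) xy) p ∧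
      ¬ 0 < eval (circ ((i + 1) * ψ) xy) p with hB
  have hroot : ∀ i ∈ B, ∃ r ∈ Set.Ioc (s i) (s (i + 1 : ℕ)), R.IsRoot r ∧ R ≠ 0 := by
    intro i hi
    obtain ⟨h1, h2⟩ := (Finset.mem_filter.mp hi).2
    have hpos : 0 < R.eval (s i) := by
      rw [hval i i.2.le]; positivity
    have hneg : R.eval (s (i + 1 : ℕ)) ≤ 0 := by
      rw [hval _ i.2]
      push_cast
      exact mul_nonpos_of_nonneg_of_nonpos (by positivity) (not_lt.mp h2)
    obtain ⟨r, hr, hr0⟩ := intermediate_value_Icc' (hsmono i (i + 1) (Nat.le_succ _) i.2)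
      (R.continuous.continuousOn) ⟨hneg, hpos.le⟩
    refine ⟨r, ⟨lt_of_le_of_ne hr.1 ?_, hr.2⟩, hr0, ?_⟩
    · rintro rfl
      exact hpos.ne' hr0
    · rintro rfl
      simp at hpos
  choose! r hrmem hr using hroot
  have hinj : Set.InjOn r B := by
    have hlt : ∀ i ∈ B, ∀ j ∈ B, i < j → r i < r j := fun i hi j hj hij =>
      ((hrmem i hi).2.trans (hsmono (i + 1) j (Nat.succ_le_of_lt hij) j.2.le)).trans_lt
        (hrmem j hj).1
    intro i hi j hj hij
    rcases lt_trichotomy i j with h | h | h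
    · exact absurd hij (hlt i hi j hj h).ne
    · exact h
    · exact absurd hij (hlt j hj i hi h).ne'
  calc B.card = (B.image r).card := (Finset.card_image_of_injOn hinj).symm
    _ ≤ R.roots.toFinset.card := Finset.card_le_card fun x hx => by
        obtain ⟨i, hi, rfl⟩ := Finset.mem_image.mp hx
        simpa [(hr i hi).2] using (hr i hi).1
    _ ≤ 2 * d := (Multiset.toFinset_card_le _).trans ((Polynomial.card_roots' R).trans hRdeg)

instance isProbabilityMeasure_gaussianPi (ι : Type*) [Fintype ι] :
    IsProbabilityMeasure (gaussianPi ι) := by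
  unfold gaussianPi; infer_instance

/-- The law of a family of independent standard Gaussian vectors of `ℝⁿ`. -/
def gaussianFam (κ : Type*) [Fintype κ] (n : ℕ) : Measure (κ → Fin n → ℝ) :=
  Measure.pi fun _ => gaussianPi (Fin n)

instance isProbabilityMeasure_gaussianFam (κ : Type*) [Fintype κ] (n : ℕ) :
    IsProbabilityMeasure (gaussianFam κ n) := by
  unfold gaussianFam; infer_instance

/-- The linear combination of the vectors `X l` with coefficients `u l`. -/
def comb {κ : Type*} [Fintype κ] {n : ℕ} (u : κ → ℝ) (X : κ → Fin n → ℝ) : Fin n → ℝ :=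
  ∑ l, u l • X l

lemma continuous_comb {κ : Type*} [Fintype κ] {n : ℕ} :
    Continuous fun q : (κ → ℝ) × (κ → Fin n → ℝ) => comb q.1 q.2 := by
  unfold comb
  fun_prop

lemma measurable_comb {κ : Type*} [Fintype κ] {n : ℕ} (u : κ → ℝ) :
    Measurable (comb (n := n) u) :=
  (continuous_comb.comp (by fun_prop : Continuous fun X => (u, X))).measurable

lemma charFunDual_gaussianReal_std (L : StrongDual ℝ ℝ) :
    charFunDual (gaussianReal 0 1) L = Complex.exp ((-(L 1) ^ 2 / 2 : ℝ)) := by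
  have hL : L = InnerProductSpace.toDualMap ℝ ℝ (L 1) := by
    ext; simp
  conv_lhs => rw [hL, ← charFun_eq_charFunDual_toDualMap, charFun_gaussianReal]
  congr 1
  push_cast
  simp
  ring

lemma charFunDual_gaussianFam {κ : Type*} [Fintype κ] {n : ℕ}
    (L : StrongDual ℝ (κ → Fin n → ℝ)) :
    charFunDual (gaussianFam κ n) L =
      Complex.exp ((-(∑ l, ∑ i, L (Pi.single l (Pi.single i 1)) ^ 2) / 2 : ℝ)) := by
  unfold gaussianFam gaussianPi
  simp only [charFunDual_pi, charFunDual_gaussianReal_std, ← Complex.exp_sum]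
  congr 1
  push_cast
  rw [neg_div, Finset.sum_div, ← Finset.sum_neg_distrib]
  refine Finset.sum_congr rfl fun l _ => ?_
  rw [Finset.sum_div, ← Finset.sum_neg_distrib]
  refine Finset.sum_congr rfl fun i _ => ?_
  simp [neg_div]

lemma measurable_comb_pair {κ : Type*} [Fintype κ] {n : ℕ} (u w : κ → ℝ) :
    Measurable fun X : κ → Fin n → ℝ => (comb u X, comb w X) :=
  (measurable_comb u).prodMk (measurable_comb w)

lemma comb_single {κ : Type*} [Fintype κ] {n : ℕ} (u : κ → ℝ) (l : κ) (x : Fin n → ℝ) :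
    comb u (Pi.single l x) = u l • x := by
  unfold comb
  rw [Finset.sum_eq_single l]
  · simp
  · intro b _ hb
    simp [Pi.single_eq_of_ne hb]
  · simp

lemma charFunDual_map_comb {κ : Type*} [Fintype κ] {n : ℕ} (u w : κ → ℝ)
    (L : StrongDual ℝ ((Fin n → ℝ) × (Fin n → ℝ))) :
    charFunDual ((gaussianFam κ n).map (fun X => (comb u X, comb w X))) L =
      Complex.exp ((-(∑ i, (L (Pi.single i 1, 0) ^ 2 * (∑ l, u l ^ 2) +
        2 * L (Pi.single i 1, 0) * L (0, Pi.single i 1) * (∑ l, u l * w l) +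
        L (0, Pi.single i 1) ^ 2 * ∑ l, w l ^ 2)) / 2 : ℝ)) := by
  let T : (κ → Fin n → ℝ) →L[ℝ] (Fin n → ℝ) × (Fin n → ℝ) :=
    (∑ l, u l • ContinuousLinearMap.proj l).prod (∑ l, w l • ContinuousLinearMap.proj l)
  have hT : ⇑T = fun X => (comb u X, comb w X) := by
    funext X
    simp [T, comb]
  rw [← hT, charFunDual_map, charFunDual_gaussianFam, Finset.sum_comm]
  refine congrArg (fun s : ℝ => Complex.exp ((-s / 2 : ℝ))) (Finset.sum_congr rfl fun i _ => ?_)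
  simp only [Finset.mul_sum, ← Finset.sum_add_distrib]
  refine Finset.sum_congr rfl fun l _ => ?_
  have hLT : (L.comp T) (Pi.single l (Pi.single i 1)) =
      u l * L (Pi.single i 1, 0) + w l * L (0, Pi.single i 1) := by
    rw [ContinuousLinearMap.comp_apply, hT]
    simp only [comb_single]
    rw [← smul_eq_mul, ← smul_eq_mul, ← map_smul, ← map_smul, ← map_add]
    simp
  rw [hLT]
  ring

/-- The joint law of two linear combinations of independent standard Gaussian vectors depends
only on the Gram matrix of the coefficient vectors. -/
lemma map_comb_eq {κ κ' : Type*} [Fintype κ] [Fintype κ'] {n : ℕ} {u w : κ → ℝ} {u' w' : κ' → ℝ}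
    (huu : ∑ l, u l ^ 2 = ∑ l, u' l ^ 2) (huw : ∑ l, u l * w l = ∑ l, u' l * w' l)
    (hww : ∑ l, w l ^ 2 = ∑ l, w' l ^ 2) :
    (gaussianFam κ n).map (fun X => (comb u X, comb w X)) =
      (gaussianFam κ' n).map (fun X => (comb u' X, comb w' X)) := by
  have := Measure.isProbabilityMeasure_map (μ := gaussianFam κ n)
    (measurable_comb_pair u w).aemeasurable
  have := Measure.isProbabilityMeasure_map (μ := gaussianFam κ' n)
    (measurable_comb_pair u' w').aemeasurable
  refine Measure.ext_of_charFunDual (funext fun L => ?_)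
  rw [charFunDual_map_comb, charFunDual_map_comb, huu, huw, hww]

/-- The law of a pair of independent standard Gaussian vectors of `ℝⁿ`. -/
def gaussianPair (n : ℕ) : Measure ((Fin n → ℝ) × (Fin n → ℝ)) :=
  (gaussianPi (Fin n)).prod (gaussianPi (Fin n))

instance isProbabilityMeasure_gaussianPair (n : ℕ) :
    IsProbabilityMeasure (gaussianPair n) := by
  unfold gaussianPair; infer_instance

lemma measurable_circ_pair {n : ℕ} (φ φ' : ℝ) :
    Measurable fun xy : (Fin n → ℝ) × (Fin n → ℝ) => (circ φ xy, circ φ' xy) :=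
  (measurable_circ φ).prodMk (measurable_circ φ')

lemma map_circ_eq_map_comb {n : ℕ} (φ φ' : ℝ) :
    (gaussianPair n).map (fun xy => (circ φ xy, circ φ' xy)) =
      (gaussianFam (Fin 2) n).map fun X =>
        (comb ![Real.cos φ, Real.sin φ] X, comb ![Real.cos φ', Real.sin φ'] X) := by
  have h := (measurePreserving_finTwoArrow (gaussianPi (Fin n))).map_eq
  rw [gaussianPair, ← h, Measure.map_map (measurable_circ_pair φ φ')
    (MeasurableEquiv.measurable _)]
  rw [gaussianFam]
  congr 1
  funext X
  simp [comb, circ, MeasurableEquiv.finTwoArrow]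

lemma map_comb_eq_map_circ {κ : Type*} [Fintype κ] {n : ℕ} {u w : κ → ℝ} {φ φ' : ℝ}
    (hu : ∑ l, u l ^ 2 = 1) (hw : ∑ l, w l ^ 2 = 1)
    (huw : ∑ l, u l * w l = Real.cos (φ - φ')) :
    (gaussianFam κ n).map (fun X => (comb u X, comb w X)) =
      (gaussianPair n).map fun xy => (circ φ xy, circ φ' xy) := by
  rw [map_circ_eq_map_comb]
  refine map_comb_eq ?_ ?_ ?_
  · simp [hu]
  · simp [huw, Real.cos_sub]
  · simp [hw]

lemma map_circ_congr {n : ℕ} {φ φ' ψ ψ' : ℝ} (h : Real.cos (φ - φ') = Real.cos (ψ - ψ')) :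
    (gaussianPair n).map (fun xy => (circ φ xy, circ φ' xy)) =
      (gaussianPair n).map fun xy => (circ ψ xy, circ ψ' xy) := by
  rw [map_circ_eq_map_comb]
  refine map_comb_eq_map_circ ?_ ?_ ?_
  · simp
  · simp
  · simp [← h, Real.cos_sub]

lemma map_circ {n : ℕ} (φ : ℝ) : (gaussianPair n).map (circ φ) = gaussianPi (Fin n) := by
  have h := map_circ_congr (n := n) (φ := φ) (φ' := φ) (ψ := 0) (ψ' := 0) (by simp)
  have h' := congrArg (Measure.map Prod.fst) h
  rw [Measure.map_map measurable_fst (measurable_circ_pair _ _),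
    Measure.map_map measurable_fst (measurable_circ_pair _ _)] at h'
  have h0 : (Prod.fst ∘ fun xy : (Fin n → ℝ) × (Fin n → ℝ) => (circ 0 xy, circ 0 xy)) =
      Prod.fst := by
    funext xy; simp [circ_zero]
  rw [h0, gaussianPair, Measure.map_fst_prod] at h'
  simpa [Function.comp_def, gaussianPair] using h'

lemma map_comb {κ : Type*} [Fintype κ] {n : ℕ} {u : κ → ℝ} (hu : ∑ l, u l ^ 2 = 1) :
    (gaussianFam κ n).map (comb u) = gaussianPi (Fin n) := by
  have h := map_comb_eq_map_circ (n := n) (φ := 0) (φ' := 0) hu hu (by simpa [sq] using hu)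
  have h' := congrArg (Measure.map Prod.fst) h
  rw [Measure.map_map measurable_fst (measurable_circ_pair _ _),
    Measure.map_map measurable_fst ((measurable_comb u).prodMk (measurable_comb u))] at h'
  simpa [Function.comp_def, ← map_circ (n := n) 0] using h'

lemma sum_measureReal_le {Ω : Type*} [MeasurableSpace Ω] {μ : Measure Ω} [IsProbabilityMeasure μ]
    {K N : ℕ} {A : Fin K → Set Ω} (hA : ∀ i, MeasurableSet (A i))
    (h : ∀ ω, (Finset.univ.filter fun i => ω ∈ A i).card ≤ N) : ∑ i, μ.real (A i) ≤ N := by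
  have hint : ∀ i, Integrable ((A i).indicator (1 : Ω → ℝ)) μ := fun i =>
    (integrable_const (1 : ℝ)).indicator (hA i)
  calc ∑ i, μ.real (A i) = ∑ i, ∫ ω, (A i).indicator (1 : Ω → ℝ) ω ∂μ := by
        simp [integral_indicator_one, hA]
    _ = ∫ ω, ∑ i, (A i).indicator (1 : Ω → ℝ) ω ∂μ := (integral_finsetSum _ fun i _ => hint i).symm
    _ ≤ ∫ _, (N : ℝ) ∂μ := by
        refine integral_mono (integrable_finsetSum _ fun i _ => hint i) (integrable_const _)
          fun ω => ?_
        have : ∑ i, (A i).indicator (1 : Ω → ℝ) ω =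
            ((Finset.univ.filter fun i => ω ∈ A i).card : ℝ) := by
          simp [Set.indicator_apply]
        simp only [this]
        exact_mod_cast h ω
    _ = N := by simp

lemma abs_measureReal_sub_le {Ω : Type*} [MeasurableSpace Ω] {μ : Measure Ω} [IsFiniteMeasure μ]
    {A B E : Set Ω} (hAB : A ⊆ B ∪ E) (hBA : B ⊆ A ∪ E) :
    |μ.real A - μ.real B| ≤ μ.real E := by
  have h1 := (measureReal_mono (μ := μ) hAB).trans (measureReal_union_le B E)
  have h2 := (measureReal_mono (μ := μ) hBA).trans (measureReal_union_le A E)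
  rw [abs_le]
  constructor <;> linarith

lemma exists_nat_div_le (C : ℝ) {δ : ℝ} (hδ : 0 < δ) : ∃ K : ℕ, 0 < K ∧ C / K ≤ δ := by
  obtain ⟨K, hK⟩ := exists_nat_gt (|C| / δ)
  have hK0 : (0 : ℝ) < K := lt_of_le_of_lt (by positivity) hK
  refine ⟨K, by exact_mod_cast hK0, ?_⟩
  rw [div_lt_iff₀ hδ] at hK
  rw [div_le_iff₀ hK0]
  linarith [le_abs_self C]

/-- The set of points where `p` is small compared with its value at the antipodal point. -/
def antipodalSmall {n : ℕ} (η : ℝ) (p : MvPolynomial (Fin n) ℝ) : Set (Fin n → ℝ) :=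
  {x | |eval x p| ≤ η * |eval (-x) p| ∧ eval (-x) p ≠ 0}

lemma measurable_eval {n : ℕ} (p : MvPolynomial (Fin n) ℝ) :
    Measurable fun x : Fin n → ℝ => eval x p :=
  (MvPolynomial.continuous_eval p).measurable

lemma measurableSet_antipodalSmall {n : ℕ} (η : ℝ) (p : MvPolynomial (Fin n) ℝ) :
    MeasurableSet (antipodalSmall η p) := by
  have h1 := measurable_eval p
  have h2 : Measurable fun x : Fin n → ℝ => eval (-x) p := h1.comp measurable_neg
  exact (measurableSet_le h1.abs (h2.abs.const_mul η)).inter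
    (h2 (measurableSet_singleton (0 : ℝ)).compl)

/-- Dimension-free small ball estimate. -/
lemma exists_antipodalSmall_le (d : ℕ) {δ : ℝ} (hδ : 0 < δ) :
    ∃ η : ℝ, 0 < η ∧ ∀ (n : ℕ) (p : MvPolynomial (Fin n) ℝ), p.totalDegree ≤ d →
      (gaussianPi (Fin n)).real (antipodalSmall η p) ≤ δ := by
  obtain ⟨K, hK0, hK⟩ := exists_nat_div_le (2 * d : ℕ) hδ
  have hpi := Real.pi_pos
  set φ : Fin K → ℝ := fun i => Real.pi * ((i : ℝ) + 1) / (K + 1) with hφ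
  have hinj : Function.Injective φ := by
    intro i j hij
    have h1 : Real.pi * ((i : ℝ) + 1) = Real.pi * ((j : ℝ) + 1) :=
      (div_left_inj' (by positivity)).mp hij
    have h2 := mul_left_cancel₀ hpi.ne' h1
    have h3 : ((i : ℕ) : ℝ) = ((j : ℕ) : ℝ) := by linarith
    exact Fin.ext (by exact_mod_cast h3)
  have hmem : ∀ i, φ i ∈ Set.Ioo 0 Real.pi := by
    intro i
    refine ⟨by positivity, ?_⟩
    have hi : ((i : ℕ) : ℝ) < K := by exact_mod_cast i.2
    rw [hφ]
    simp only
    rw [div_lt_iff₀ (by positivity)]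
    gcongr
  obtain ⟨η, hη, h⟩ := exists_card_smallBall_le d K φ hinj hmem
  refine ⟨η, hη, fun n p hp => ?_⟩
  have hsum := sum_measureReal_le (μ := gaussianPair n)
    (fun i => measurable_circ (φ i) (measurableSet_antipodalSmall η p)) (N := 2 * d)
    (fun xy => (le_of_eq (congrArg Finset.card (by
      ext i; rw [Finset.mem_filter, Finset.mem_filter]; rfl))).trans (h n p hp xy))
  have heq : ∀ i, (gaussianPair n).real (circ (φ i) ⁻¹' antipodalSmall η p) =
      (gaussianPi (Fin n)).real (antipodalSmall η p) := fun i => by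
    rw [← map_circ (φ i), map_measureReal_apply (measurable_circ _)
      (measurableSet_antipodalSmall η p)]
  simp only [heq, Finset.sum_const, Finset.card_univ, Fintype.card_fin, nsmul_eq_mul] at hsum
  refine le_trans ?_ hK
  rw [le_div_iff₀ (by exact_mod_cast hK0)]
  linarith

/-- The law of a pair of standard Gaussian vectors with correlation `cos ψ`. -/
def pairLaw (n : ℕ) (ψ : ℝ) : Measure ((Fin n → ℝ) × (Fin n → ℝ)) :=
  (gaussianPair n).map fun xy => (circ 0 xy, circ ψ xy)

instance isProbabilityMeasure_pairLaw (n : ℕ) (ψ : ℝ) : IsProbabilityMeasure (pairLaw n ψ) :=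
  Measure.isProbabilityMeasure_map (measurable_circ_pair _ _).aemeasurable

lemma map_circ_eq_pairLaw {n : ℕ} {φ φ' ψ : ℝ} (h : Real.cos (φ - φ') = Real.cos ψ) :
    (gaussianPair n).map (fun xy => (circ φ xy, circ φ' xy)) = pairLaw n ψ :=
  map_circ_congr (by rw [h, zero_sub, Real.cos_neg])

lemma pairLaw_swap (n : ℕ) (ψ : ℝ) : (pairLaw n ψ).map Prod.swap = pairLaw n ψ := by
  rw [pairLaw, Measure.map_map measurable_swap (measurable_circ_pair _ _)]
  exact map_circ_eq_pairLaw (by simp)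

/-- The pairs of points between which the sign of `p` changes from positive to nonpositive. -/
def signChange {n : ℕ} (p : MvPolynomial (Fin n) ℝ) : Set ((Fin n → ℝ) × (Fin n → ℝ)) :=
  {z | 0 < eval z.1 p ∧ ¬ 0 < eval z.2 p}

lemma measurableSet_signChange {n : ℕ} (p : MvPolynomial (Fin n) ℝ) :
    MeasurableSet (signChange p) :=
  (measurableSet_lt measurable_const ((measurable_eval p).comp measurable_fst)).inter
    (measurableSet_lt measurable_const ((measurable_eval p).comp measurable_snd)).compl

lemma pairLaw_signChange_le {n d K : ℕ} (hK : 0 < K) {p : MvPolynomial (Fin n) ℝ}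
    (hp : p.totalDegree ≤ d) {ψ : ℝ} (hψ : 0 ≤ ψ) (hKψ : K * ψ < Real.pi) :
    (pairLaw n ψ).real (signChange p) ≤ 2 * d / K := by
  have hsum := sum_measureReal_le (μ := gaussianPair n) (fun i : Fin K =>
    measurable_circ_pair (i * ψ) ((i + 1) * ψ) (measurableSet_signChange p)) (N := 2 * d)
    (fun xy => (le_of_eq (congrArg Finset.card (by ext i; simp [signChange]))).trans
      (card_signChange_le hp hψ hKψ xy))
  have heq : ∀ i : Fin K, (gaussianPair n).real
      ((fun xy => (circ (i * ψ) xy, circ ((i + 1) * ψ) xy)) ⁻¹' signChange p) =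
      (pairLaw n ψ).real (signChange p) := fun i => by
    rw [← map_measureReal_apply (measurable_circ_pair _ _) (measurableSet_signChange p),
      map_circ_eq_pairLaw]
    rw [← Real.cos_neg]
    congr 1
    ring
  simp only [heq, Finset.sum_const, Finset.card_univ, Fintype.card_fin, nsmul_eq_mul] at hsum
  rw [le_div_iff₀ (by exact_mod_cast hK)]
  push_cast at hsum
  linarith

lemma measurableSet_agree {n m k : ℕ} {f : (Fin n → ℝ) → Fin k} {g : (Fin m → ℝ) → Fin k}
    (hf : Measurable f) (hg : Measurable g) : MeasurableSet {z : (Fin n → ℝ) × (Fin m → ℝ) |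
      f z.1 = g z.2} :=
  measurableSet_eq_fun (hf.comp measurable_fst) (hg.comp measurable_snd)

lemma pairLaw_disagree_le {n d k K : ℕ} [NeZero k] (hK : 0 < K)
    {p : Fin k → MvPolynomial (Fin n) ℝ} (hp : ∀ j, (p j).totalDegree ≤ d) {ψ : ℝ} (hψ : 0 ≤ ψ)
    (hKψ : K * ψ < Real.pi) :
    (pairLaw n ψ).real {z | ptf p z.1 = ptf p z.2}ᶜ ≤ 4 * k * d / K := by
  have hsub : {z : (Fin n → ℝ) × (Fin n → ℝ) | ptf p z.1 = ptf p z.2}ᶜ ⊆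
      ⋃ j ∈ Finset.univ, (signChange (p j) ∪ Prod.swap ⁻¹' signChange (p j)) := by
    intro z hz
    by_contra hne
    refine hz (ptfSel_congr fun j => ?_)
    simp only [Finset.mem_univ, Set.iUnion_true, Set.mem_iUnion, not_exists, signChange,
      Set.mem_union, Set.mem_preimage, Set.mem_ofPred_eq, Prod.fst_swap, Prod.snd_swap] at hne
    have := hne j
    tauto
  have hswap : ∀ j, (pairLaw n ψ).real (Prod.swap ⁻¹' signChange (p j)) =
      (pairLaw n ψ).real (signChange (p j)) := fun j => by
    rw [← map_measureReal_apply measurable_swap (measurableSet_signChange _), pairLaw_swap]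
  calc _ ≤ _ := measureReal_mono hsub (measure_ne_top _ _)
    _ ≤ ∑ j, (pairLaw n ψ).real (signChange (p j) ∪ Prod.swap ⁻¹' signChange (p j)) :=
        measureReal_biUnion_finset_le _ _
    _ ≤ ∑ _j : Fin k, (2 * d / K + 2 * d / K : ℝ) := by
        refine Finset.sum_le_sum fun j _ => (measureReal_union_le _ _).trans ?_
        rw [hswap]
        have := pairLaw_signChange_le hK (hp j) hψ hKψ
        linarith
    _ = 4 * k * d / K := by simp; ring

/-- The probability that `f` agrees at two standard Gaussian vectors with correlation `cos ψ`. -/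
def agreeProb {n k : ℕ} (f : (Fin n → ℝ) → Fin k) (ψ : ℝ) : ℝ :=
  (pairLaw n ψ).real {z | f z.1 = f z.2}

/-- The agreement probability of a PTF is uniformly continuous in the angle, with a modulus that
does not depend on the dimension. -/
lemma exists_agreeProb_modulus (d k : ℕ) [NeZero k] {δ : ℝ} (hδ : 0 < δ) :
    ∃ θ : ℝ, 0 < θ ∧ ∀ (n : ℕ) (p : Fin k → MvPolynomial (Fin n) ℝ),
      (∀ j, (p j).totalDegree ≤ d) → ∀ ψ ψ' : ℝ, |ψ - ψ'| ≤ θ →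
        |agreeProb (ptf p) ψ - agreeProb (ptf p) ψ'| ≤ δ := by
  obtain ⟨K, hK0, hK⟩ := exists_nat_div_le (4 * k * d) hδ
  have hK0' : (0 : ℝ) < K := by exact_mod_cast hK0
  have hpi := Real.pi_pos
  refine ⟨Real.pi / (2 * K), by positivity, fun n p hp ψ ψ' hψ => ?_⟩
  have hf := measurable_ptf p
  have hA := measurableSet_agree hf hf
  have hKψ : K * |ψ - ψ'| < Real.pi := by
    rw [le_div_iff₀ (by positivity)] at hψ
    nlinarith
  refine le_trans ?_ ((pairLaw_disagree_le hK0 hp (abs_nonneg (ψ - ψ')) hKψ).trans hK)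
  rw [← map_circ_eq_pairLaw (φ := ψ) (φ' := ψ') (by rw [Real.cos_abs]),
    map_measureReal_apply (measurable_circ_pair _ _) hA.compl, agreeProb, agreeProb, pairLaw,
    pairLaw, map_measureReal_apply (measurable_circ_pair _ _) hA,
    map_measureReal_apply (measurable_circ_pair _ _) hA]
  refine abs_measureReal_sub_le ?_ ?_ <;> intro xy hxy <;>
    simp only [Set.mem_union, Set.mem_preimage, Set.mem_compl_iff, Set.mem_ofPred_eq] at hxy ⊢ <;>
    grind

lemma gMean_eq {n k : ℕ} {f : (Fin n → ℝ) → Fin k} (hf : Measurable f) (j : Fin k) :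
    gMean f j = (gaussianPi (Fin n)).real (f ⁻¹' {j}) := by
  rw [gMean, ← integral_indicator_one (hf (measurableSet_singleton j))]
  refine integral_congr_ae (Filter.Eventually.of_forall fun x => ?_)
  by_cases h : f x = j
  · simp [basisVec, h]
  · simp [basisVec, h, Ne.symm h]

lemma integral_indicator_left {Ω Z : Type*} [MeasurableSpace Ω] [MeasurableSpace Z]
    (ζ : Measure Z) {E : Set (Ω × Z)} (hE : MeasurableSet E) (ω : Ω) :
    ∫ z, E.indicator (1 : Ω × Z → ℝ) (ω, z) ∂ζ = ζ.real {z | (ω, z) ∈ E} := by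
  have h : MeasurableSet {z | (ω, z) ∈ E} := measurable_prodMk_left hE
  rw [← integral_indicator_one h]
  rfl

lemma integral_indicator_right {Ω Z : Type*} [MeasurableSpace Ω] [MeasurableSpace Z]
    (μ : Measure Ω) {E : Set (Ω × Z)} (hE : MeasurableSet E) (z : Z) :
    ∫ ω, E.indicator (1 : Ω × Z → ℝ) (ω, z) ∂μ = μ.real {ω | (ω, z) ∈ E} := by
  have h : MeasurableSet {ω | (ω, z) ∈ E} := measurable_prodMk_right hE
  rw [← integral_indicator_one h]
  rfl

lemma integral_measureReal_swap {Ω Z : Type*} [MeasurableSpace Ω] [MeasurableSpace Z]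
    {μ : Measure Ω} {ζ : Measure Z} [IsProbabilityMeasure μ] [IsProbabilityMeasure ζ]
    {E : Set (Ω × Z)} (hE : MeasurableSet E) :
    Integrable (fun ω => ζ.real {z | (ω, z) ∈ E}) μ ∧
      Integrable (fun z => μ.real {ω | (ω, z) ∈ E}) ζ ∧
      ∫ ω, ζ.real {z | (ω, z) ∈ E} ∂μ = ∫ z, μ.real {ω | (ω, z) ∈ E} ∂ζ := by
  have hint : Integrable (E.indicator (1 : Ω × Z → ℝ)) (μ.prod ζ) :=
    (integrable_const (1 : ℝ)).indicator hE
  simp only [← integral_indicator_left ζ hE, ← integral_indicator_right μ hE]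
  exact ⟨hint.integral_prod_left, hint.integral_prod_right, integral_integral_swap hint⟩

lemma measureReal_prod_eq_integral {Ω Z : Type*} [MeasurableSpace Ω] [MeasurableSpace Z]
    {μ : Measure Ω} {ζ : Measure Z} [IsProbabilityMeasure μ] [IsProbabilityMeasure ζ]
    {E : Set (Ω × Z)} (hE : MeasurableSet E) :
    (μ.prod ζ).real E = ∫ ω, ζ.real {z | (ω, z) ∈ E} ∂μ := by
  have hint : Integrable (E.indicator (1 : Ω × Z → ℝ)) (μ.prod ζ) :=
    (integrable_const (1 : ℝ)).indicator hE
  rw [← integral_indicator_one hE, integral_prod _ hint]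
  simp only [integral_indicator_left ζ hE]

lemma agreeProb_eq {n k : ℕ} {f : (Fin n → ℝ) → Fin k} (hf : Measurable f) (ψ : ℝ) :
    agreeProb f ψ = (gaussianPair n).real {xy | f xy.1 = f (circ ψ xy)} := by
  rw [agreeProb, pairLaw, map_measureReal_apply (measurable_circ_pair _ _)
    (measurableSet_agree hf hf)]
  congr 1
  ext xy
  simp [circ_zero]

/-- Noise stability is an agreement probability. -/
lemma noiseStab_eq {n k : ℕ} {f : (Fin n → ℝ) → Fin k} (hf : Measurable f) (t : ℝ) (ht : 0 < t) :
    noiseStab t f = agreeProb f (Real.arccos (Real.exp (-t))) := by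
  have hcos : Real.cos (Real.arccos (Real.exp (-t))) = Real.exp (-t) :=
    Real.cos_arccos (by linarith [Real.exp_pos (-t)]) (Real.exp_le_one_iff.mpr (by linarith))
  have hsin : Real.sin (Real.arccos (Real.exp (-t))) = Real.sqrt (1 - Real.exp (-2 * t)) := by
    rw [Real.sin_arccos, sq, ← Real.exp_add]
    congr 3
    ring
  set ψ := Real.arccos (Real.exp (-t)) with hψ
  have hset : MeasurableSet {xy : (Fin n → ℝ) × (Fin n → ℝ) | f xy.1 = f (circ ψ xy)} :=
    measurableSet_eq_fun (hf.comp measurable_fst) (hf.comp (measurable_circ ψ))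
  rw [agreeProb_eq hf, gaussianPair, measureReal_prod_eq_integral hset, noiseStab]
  refine integral_congr_ae (Filter.Eventually.of_forall fun x => ?_)
  have harg : ∀ y : Fin n → ℝ, (fun i => Real.exp (-t) * x i +
      Real.sqrt (1 - Real.exp (-2 * t)) * y i) = circ ψ (x, y) := by
    intro y
    funext i
    simp [circ, hcos, hsin]
  simp only [ouOp, harg]
  rw [Finset.sum_eq_single (f x) (fun j _ hj => by simp [basisVec, hj]) (by simp),
    ← integral_indicator_left _ hset]
  simp only [basisVec, if_true, one_mul]
  refine integral_congr_ae (Filter.Eventually.of_forall fun y => ?_)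
  simp [Set.indicator_apply]

/-- For independent arguments the agreement probability is the collision probability. -/
lemma agreeProb_pi_div_two {n k : ℕ} {f : (Fin n → ℝ) → Fin k} (hf : Measurable f) :
    agreeProb f (Real.pi / 2) = ∑ j, gMean f j ^ 2 := by
  have hset := measurableSet_agree hf hf
  have hcirc : ∀ xy : (Fin n → ℝ) × (Fin n → ℝ), circ (Real.pi / 2) xy = xy.2 := fun xy => by
    simp [circ]
  rw [agreeProb_eq hf]
  simp only [hcirc]
  have hU : {xy : (Fin n → ℝ) × (Fin n → ℝ) | f xy.1 = f xy.2} =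
      ⋃ j ∈ Finset.univ, (f ⁻¹' {j}) ×ˢ (f ⁻¹' {j}) := by
    ext xy
    simp [eq_comm]
  rw [hU, measureReal_biUnion_finset]
  · refine Finset.sum_congr rfl fun j _ => ?_
    rw [gaussianPair, measureReal_prod_prod, gMean_eq hf, sq]
  · intro i _ j _ hij
    refine Set.disjoint_left.mpr fun xy hi hj => hij ?_
    exact (Set.mem_prod.mp hi).1.symm.trans (Set.mem_prod.mp hj).1
  · exact fun j _ => (hf (measurableSet_singleton j)).prod (hf (measurableSet_singleton j))

lemma gMean_nonneg {n k : ℕ} {f : (Fin n → ℝ) → Fin k} (hf : Measurable f) (j : Fin k) :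
    0 ≤ gMean f j := by
  rw [gMean_eq hf]; exact measureReal_nonneg

lemma sum_gMean {n k : ℕ} {f : (Fin n → ℝ) → Fin k} (hf : Measurable f) :
    ∑ j, gMean f j = 1 := by
  simp only [gMean_eq hf]
  rw [sum_measureReal_preimage_singleton]
  · simp
  · exact fun j _ => hf (measurableSet_singleton j)

/-- Weak law of large numbers for a centred square integrable function. -/
lemma measureReal_sum_pi_ge_le {Ω : Type*} [MeasurableSpace Ω] {ρ : Measure Ω}
    [IsProbabilityMeasure ρ] {X : Ω → ℝ} (hX : MemLp X 2 ρ) (hmean : ∫ ω, X ω ∂ρ = 0) {D : ℕ}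
    (hD : 0 < D) {η : ℝ} (hη : 0 < η) :
    (Measure.pi fun _ : Fin D => ρ).real {ω | η * D ≤ |∑ l, X (ω l)|} ≤
      Var[X; ρ] / η ^ 2 / D := by
  have hD' : (0 : ℝ) < D := by exact_mod_cast hD
  have hXl : ∀ l : Fin D, MemLp (fun ω : Fin D → Ω => X (ω l)) 2 (Measure.pi fun _ => ρ) :=
    fun l => hX.comp_measurePreserving (measurePreserving_eval (fun _ : Fin D => ρ) l)
  have hmemLp : MemLp (∑ l : Fin D, fun ω : Fin D → Ω => X (ω l)) 2 (Measure.pi fun _ => ρ) :=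
    memLp_finsetSum' _ fun l _ => hXl l
  have hvar := variance_sum_pi (μ := fun _ : Fin D => ρ) (X := fun _ => X) fun _ => hX
  have hint : ∫ ω, (∑ l : Fin D, fun ω : Fin D → Ω => X (ω l)) ω
      ∂(Measure.pi fun _ : Fin D => ρ) = 0 := by
    simp only [Finset.sum_apply]
    rw [integral_finsetSum _ fun l _ => (hXl l).integrable (by norm_num)]
    refine Finset.sum_eq_zero fun l _ => ?_
    rw [← hmean]
    exact integral_comp_eval (μ := fun _ : Fin D => ρ) (i := l) hX.aestronglyMeasurable
  have hch := meas_ge_le_variance_div_sq hmemLp (c := η * D) (by positivity)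
  rw [hint, hvar] at hch
  have := ENNReal.toReal_mono ENNReal.ofReal_ne_top hch
  rw [ENNReal.toReal_ofReal (div_nonneg
    (Finset.sum_nonneg fun _ _ => variance_nonneg _ _) (by positivity))] at this
  simp only [sub_zero, Finset.sum_apply, Finset.sum_const, Finset.card_univ, Fintype.card_fin,
    nsmul_eq_mul] at this
  refine this.trans (le_of_eq ?_)
  field_simp

lemma integrable_pow_gaussianReal (m : ℕ) :
    Integrable (fun x : ℝ => x ^ m) (gaussianReal 0 1) := by
  have h := (memLp_id_gaussianReal (μ := 0) (v := 1) m).integrable_norm_pow'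
  refine h.mono (by fun_prop) (Filter.Eventually.of_forall fun x => ?_)
  simp

lemma integral_sq_gaussianReal : ∫ x, x ^ 2 ∂gaussianReal 0 1 = 1 := by
  have h := variance_id_gaussianReal (μ := 0) (v := 1)
  rw [variance_eq_integral (by fun_prop)] at h
  simpa using h

lemma memLp_sq_sub_one : MemLp (fun x : ℝ => x ^ 2 - 1) 2 (gaussianReal 0 1) := by
  rw [memLp_two_iff_integrable_sq (by fun_prop)]
  have h := ((integrable_pow_gaussianReal 4).sub ((integrable_pow_gaussianReal 2).const_mul 2)).add
    (integrable_const (1 : ℝ))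
  refine h.congr (Filter.Eventually.of_forall fun x => ?_)
  simp
  ring

lemma integral_sq_sub_one : ∫ x, (x ^ 2 - 1) ∂gaussianReal 0 1 = 0 := by
  rw [integral_sub (integrable_pow_gaussianReal 2) (integrable_const _), integral_sq_gaussianReal]
  simp

/-- The pairs of vectors of `ℝᴰ` that are nearly orthogonal, both with norm close to `√D`. -/
def goodPairs (D : ℕ) (η : ℝ) : Set ((Fin D → ℝ) × (Fin D → ℝ)) :=
  {z | |∑ l, z.1 l ^ 2 - D| ≤ η * D ∧ |∑ l, z.2 l ^ 2 - D| ≤ η * D ∧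
    |∑ l, z.1 l * z.2 l| ≤ η * D}

lemma measurableSet_goodPairs (D : ℕ) (η : ℝ) : MeasurableSet (goodPairs D η) := by
  have h1 : Measurable fun z : (Fin D → ℝ) × (Fin D → ℝ) => |∑ l, z.1 l ^ 2 - D| := by fun_prop
  have h2 : Measurable fun z : (Fin D → ℝ) × (Fin D → ℝ) => |∑ l, z.2 l ^ 2 - D| := by fun_prop
  have h3 : Measurable fun z : (Fin D → ℝ) × (Fin D → ℝ) => |∑ l, z.1 l * z.2 l| := by fun_prop
  exact (measurableSet_le h1 measurable_const).inter
    ((measurableSet_le h2 measurable_const).inter (measurableSet_le h3 measurable_const))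

lemma exists_goodPairs {η δ : ℝ} (hη : 0 < η) (hδ : 0 < δ) :
    ∃ D : ℕ, 0 < D ∧ (gaussianPair D).real (goodPairs D η)ᶜ ≤ δ := by
  set g := gaussianReal 0 1 with hg
  have hY : MemLp (fun z : ℝ × ℝ => z.1 * z.2) 2 (g.prod g) := by
    rw [memLp_two_iff_integrable_sq (by fun_prop)]
    refine ((integrable_pow_gaussianReal 2).mul_prod (integrable_pow_gaussianReal 2)).congr
      (Filter.Eventually.of_forall fun z => ?_)
    simp [mul_pow]
  have hYmean : ∫ z, z.1 * z.2 ∂(g.prod g) = 0 := by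
    rw [integral_prod_mul (fun x : ℝ => x) fun x : ℝ => x]
    simp [hg]
  set v := Var[fun x : ℝ => x ^ 2 - 1; g] with hv
  set w := Var[fun z : ℝ × ℝ => z.1 * z.2; g.prod g] with hw
  obtain ⟨D, hD, hDle⟩ := exists_nat_div_le ((2 * v + w) / η ^ 2) hδ
  refine ⟨D, hD, le_trans ?_ hDle⟩
  set A : Set (Fin D → ℝ) := {x | η * D ≤ |∑ l, (x l ^ 2 - 1)|} with hA
  set B : Set ((Fin D → ℝ) × (Fin D → ℝ)) := {z | η * D ≤ |∑ l, z.1 l * z.2 l|} with hB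
  have hAm : MeasurableSet A := measurableSet_le measurable_const (by fun_prop)
  have hBm : MeasurableSet B := measurableSet_le measurable_const (by fun_prop)
  have hAle : (gaussianPi (Fin D)).real A ≤ v / η ^ 2 / D :=
    measureReal_sum_pi_ge_le memLp_sq_sub_one integral_sq_sub_one hD hη
  have h1 : (gaussianPair D).real (Prod.fst ⁻¹' A) ≤ v / η ^ 2 / D := by
    rwa [gaussianPair, ← map_measureReal_apply measurable_fst hAm, Measure.map_fst_prod,
      measure_univ, one_smul]
  have h2 : (gaussianPair D).real (Prod.snd ⁻¹' A) ≤ v / η ^ 2 / D := by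
    rwa [gaussianPair, ← map_measureReal_apply measurable_snd hAm, Measure.map_snd_prod,
      measure_univ, one_smul]
  have h3 : (gaussianPair D).real B ≤ w / η ^ 2 / D := by
    have hmp := measurePreserving_arrowProdEquivProdArrow ℝ ℝ (Fin D) (fun _ => g) fun _ => g
    have hpair : gaussianPair D = (Measure.pi fun _ : Fin D => g).prod
      (Measure.pi fun _ : Fin D => g) := rfl
    rw [hpair, ← hmp.map_eq, map_measureReal_apply hmp.measurable hBm]
    exact measureReal_sum_pi_ge_le hY hYmean hD hη
  have hsub : (goodPairs D η)ᶜ ⊆ (Prod.fst ⁻¹' A ∪ Prod.snd ⁻¹' A) ∪ B := by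
    intro z hz
    by_contra hne
    simp only [Set.mem_union, Set.mem_preimage, not_or, hA, hB, Set.mem_ofPred_eq, not_le,
      Finset.sum_sub_distrib, Finset.sum_const, Finset.card_univ, Fintype.card_fin,
      nsmul_eq_mul, mul_one] at hne
    exact hz ⟨hne.1.1.le, hne.1.2.le, hne.2.le⟩
  calc (gaussianPair D).real (goodPairs D η)ᶜ ≤ v / η ^ 2 / D + v / η ^ 2 / D + w / η ^ 2 / D := by
        refine (measureReal_mono hsub (measure_ne_top _ _)).trans
          ((measureReal_union_le _ _).trans (add_le_add ?_ h3))
        exact (measureReal_union_le _ _).trans (add_le_add h1 h2)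
    _ = (2 * v + w) / η ^ 2 / D := by ring

lemma sum_circ_sq {D : ℕ} (α : ℝ) (z : (Fin D → ℝ) × (Fin D → ℝ)) :
    ∑ l, circ α z l ^ 2 = Real.cos α ^ 2 * ∑ l, z.1 l ^ 2 + Real.sin α ^ 2 * ∑ l, z.2 l ^ 2 +
      2 * (Real.cos α * Real.sin α) * ∑ l, z.1 l * z.2 l := by
  simp only [Finset.mul_sum, ← Finset.sum_add_distrib, circ]
  refine Finset.sum_congr rfl fun l _ => ?_
  simp
  ring

lemma sum_mul_circ {D : ℕ} (α : ℝ) (z : (Fin D → ℝ) × (Fin D → ℝ)) :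
    ∑ l, z.1 l * circ α z l =
      Real.cos α * ∑ l, z.1 l ^ 2 + Real.sin α * ∑ l, z.1 l * z.2 l := by
  simp only [Finset.mul_sum, ← Finset.sum_add_distrib, circ]
  refine Finset.sum_congr rfl fun l _ => ?_
  simp
  ring

lemma exists_arccos_modulus {θ : ℝ} (hθ : 0 < θ) : ∃ κ : ℝ, 0 < κ ∧ ∀ x α : ℝ, |x| ≤ 1 →
    α ∈ Set.Icc 0 Real.pi → |x - Real.cos α| ≤ κ → |Real.arccos x - α| ≤ θ := by
  have huc : UniformContinuousOn Real.arccos (Set.Icc (-1) 1) :=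
    isCompact_Icc.uniformContinuousOn_of_continuous Real.continuous_arccos.continuousOn
  rw [Metric.uniformContinuousOn_iff_le] at huc
  obtain ⟨κ, hκ, h⟩ := huc θ hθ
  refine ⟨κ, hκ, fun x α hx hα hxα => ?_⟩
  have := h x (abs_le.mp hx) (Real.cos α) ⟨Real.neg_one_le_cos α, Real.cos_le_one α⟩
    (by rwa [Real.dist_eq])
  rwa [Real.dist_eq, Real.arccos_cos hα.1 hα.2] at this

/-- The nonzero vectors of `ℝᴰ` whose norm is close to `√D`. -/
def nearSphere (D : ℕ) (η : ℝ) : Set (Fin D → ℝ) :=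
  {a | 0 < ∑ l, a l ^ 2 ∧
    |Real.sqrt (∑ l, a l ^ 2) - Real.sqrt D| ≤ η * (Real.sqrt (∑ l, a l ^ 2) + Real.sqrt D)}

lemma mem_nearSphere {D : ℕ} {η η' : ℝ} (hη' : η' ≤ η) (hη'1 : η' < 1) {a : Fin D → ℝ}
    (hD : 0 < D) (ha : |∑ l, a l ^ 2 - D| ≤ η' * D) : a ∈ nearSphere D η := by
  have hD' : (0 : ℝ) < D := by exact_mod_cast hD
  set A := ∑ l, a l ^ 2
  have hA : 0 < A := by
    have := (abs_le.mp ha).1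
    nlinarith
  refine ⟨hA, ?_⟩
  have hr := Real.sqrt_pos.mpr hA
  have hs := Real.sqrt_pos.mpr hD'
  have hr2 := Real.sq_sqrt hA.le
  have hs2 := Real.sq_sqrt hD'.le
  change |√A - √D| ≤ η * (√A + √D)
  have hη0 : 0 ≤ η' := by
    by_contra hneg
    have := abs_nonneg (A - D)
    nlinarith
  refine le_of_mul_le_mul_right ?_ (add_pos hr hs)
  calc |√A - √D| * (√A + √D) = |A - D| := by
        rw [← abs_of_pos (add_pos hr hs), ← abs_mul]
        congr 1
        linear_combination hr2 - hs2
    _ ≤ η' * D := ha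
    _ ≤ η * D := by gcongr
    _ ≤ η * (√A + √D) * (√A + √D) := by
        have : (D : ℝ) ≤ (√A + √D) * (√A + √D) := by nlinarith
        have h := mul_le_mul_of_nonneg_left this (hη0.trans hη')
        linarith

/-- Cosine of the angle between two vectors. -/
def cosAngle {D : ℕ} (a b : Fin D → ℝ) : ℝ :=
  (∑ l, a l * b l) / (Real.sqrt (∑ l, a l ^ 2) * Real.sqrt (∑ l, b l ^ 2))

lemma abs_cosAngle_le_one {D : ℕ} (a b : Fin D → ℝ) : |cosAngle a b| ≤ 1 := by
  have h : |∑ l, a l * b l| ≤ Real.sqrt (∑ l, a l ^ 2) * Real.sqrt (∑ l, b l ^ 2) := by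
    rw [← Real.sqrt_mul (Finset.sum_nonneg fun l _ => sq_nonneg (a l))]
    exact Real.abs_le_sqrt (Finset.sum_mul_sq_le_sq_mul_sq _ _ _)
  rw [cosAngle, abs_div, abs_of_nonneg (by positivity : 0 ≤ √(∑ l, a l ^ 2) * √(∑ l, b l ^ 2))]
  exact div_le_one_of_le₀ h (by positivity)

lemma exists_goodPairs_angle {η θ : ℝ} (hη : 0 < η) (hθ : 0 < θ) :
    ∃ η' : ℝ, 0 < η' ∧ ∀ D : ℕ, 0 < D → ∀ z ∈ goodPairs D η', ∀ α ∈ Set.Icc 0 (Real.pi / 2),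
      z.1 ∈ nearSphere D η ∧ circ α z ∈ nearSphere D η ∧
        |Real.arccos (cosAngle z.1 (circ α z)) - α| ≤ θ := by
  obtain ⟨κ, hκ, hκθ⟩ := exists_arccos_modulus hθ
  set η' := min (1 / 8) (min (η / 2) (κ / 12)) with hη'
  have hpos : 0 < η' := by positivity
  have h8 : η' ≤ 1 / 8 := min_le_left _ _
  have h2 : η' ≤ η / 2 := (min_le_right _ _).trans (min_le_left _ _)
  have h12 : η' ≤ κ / 12 := (min_le_right _ _).trans (min_le_right _ _)
  clear_value η'
  refine ⟨η', hpos, fun D hD z hz α hα => ?_⟩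
  obtain ⟨hz1, hz2, hz3⟩ := hz
  have hD' : (0 : ℝ) < D := by exact_mod_cast hD
  have hcs := Real.cos_sq_add_sin_sq α
  have hc1 := Real.abs_cos_le_one α
  have hs1 := Real.abs_sin_le_one α
  have hQ : |∑ l, circ α z l ^ 2 - D| ≤ 2 * η' * D := by
    rw [sum_circ_sq]
    set A := ∑ l, z.1 l ^ 2
    set B := ∑ l, z.2 l ^ 2
    set C := ∑ l, z.1 l * z.2 l
    have h2cs : |2 * (Real.cos α * Real.sin α)| ≤ 1 := by
      rw [abs_le]
      constructor <;> nlinarith [sq_nonneg (Real.cos α + Real.sin α),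
        sq_nonneg (Real.cos α - Real.sin α)]
    calc |Real.cos α ^ 2 * A + Real.sin α ^ 2 * B + 2 * (Real.cos α * Real.sin α) * C - D|
        = |Real.cos α ^ 2 * (A - D) + Real.sin α ^ 2 * (B - D) +
            2 * (Real.cos α * Real.sin α) * C| := by
          congr 1
          linear_combination (D : ℝ) * hcs
      _ ≤ Real.cos α ^ 2 * |A - D| + Real.sin α ^ 2 * |B - D| +
            |2 * (Real.cos α * Real.sin α)| * |C| := by
          refine (abs_add_three _ _ _).trans (le_of_eq ?_)
          rw [abs_mul, abs_mul, abs_mul _ C, abs_of_nonneg (sq_nonneg (Real.cos α)),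
            abs_of_nonneg (sq_nonneg (Real.sin α))]
      _ ≤ Real.cos α ^ 2 * (η' * D) + Real.sin α ^ 2 * (η' * D) + 1 * (η' * D) := by gcongr
      _ = 2 * η' * D := by linear_combination (η' * D) * hcs
  have hY : |∑ l, z.1 l * circ α z l - D * Real.cos α| ≤ 2 * η' * D := by
    rw [sum_mul_circ]
    set A := ∑ l, z.1 l ^ 2
    set C := ∑ l, z.1 l * z.2 l
    calc |Real.cos α * A + Real.sin α * C - D * Real.cos α|
        = |Real.cos α * (A - D) + Real.sin α * C| := by congr 1; ring
      _ ≤ |Real.cos α| * |A - D| + |Real.sin α| * |C| := by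
          rw [← abs_mul, ← abs_mul]; exact abs_add_le _ _
      _ ≤ 1 * (η' * D) + 1 * (η' * D) := by gcongr
      _ = 2 * η' * D := by ring
  refine ⟨mem_nearSphere (by linarith) (by linarith) hD hz1,
    mem_nearSphere (by linarith) (by linarith) hD hQ, ?_⟩
  refine hκθ _ _ (abs_cosAngle_le_one _ _) ⟨hα.1, by linarith [hα.2, Real.pi_pos]⟩ ?_
  rw [cosAngle]
  set A := ∑ l, z.1 l ^ 2
  set Q := ∑ l, circ α z l ^ 2
  set Y := ∑ l, z.1 l * circ α z l
  have hA0 : 0 ≤ A := by nlinarith [(abs_le.mp hz1).1]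
  have hQ0 : 0 ≤ Q := by nlinarith [(abs_le.mp hQ).1]
  rw [← Real.sqrt_mul hA0]
  set s := √(A * Q) with hs
  have hs0 : 0 ≤ s := Real.sqrt_nonneg _
  have hs2 : s ^ 2 = A * Q := Real.sq_sqrt (mul_nonneg hA0 hQ0)
  have hsD : |s - D| ≤ 4 * η' * D := by
    have h1 : |s - D| * D ≤ 4 * η' * D * D := by
      calc |s - D| * D ≤ |s - D| * (s + D) := by gcongr; linarith
        _ = |A * (Q - D) + D * (A - D)| := by
            rw [← abs_of_nonneg (by positivity : 0 ≤ s + D), ← abs_mul]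
            congr 1
            linear_combination hs2
        _ ≤ A * |Q - D| + D * |A - D| := by
            refine (abs_add_le _ _).trans (le_of_eq ?_)
            rw [abs_mul, abs_mul, abs_of_nonneg hA0, abs_of_pos hD']
        _ ≤ (3 / 2 * D) * (2 * η' * D) + D * (η' * D) := by
            gcongr
            nlinarith [(abs_le.mp hz1).2]
        _ = 4 * η' * D * D := by ring
    exact le_of_mul_le_mul_right h1 hD'
  have hslow : D / 2 ≤ s := by nlinarith [(abs_le.mp hsD).1]
  have hspos : 0 < s := by linarith
  have hdiv : Y / s - Real.cos α = (Y - s * Real.cos α) / s := by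
    field_simp
  rw [hdiv, abs_div, abs_of_pos hspos, div_le_iff₀ hspos]
  calc |Y - s * Real.cos α| = |(Y - D * Real.cos α) - (s - D) * Real.cos α| := by
        congr 1; ring
    _ ≤ |Y - D * Real.cos α| + |s - D| * |Real.cos α| := by
        rw [← abs_mul]; exact abs_sub _ _
    _ ≤ 2 * η' * D + 4 * η' * D * 1 := by gcongr
    _ ≤ κ * s := by nlinarith

/-- The polynomial `p` of degree `d` restricted to the span of the rows of `M`: a vector
`a : ℝᴰ` is sent to `∑ l, a l • M l` and the monomials of `p` are rescaled so that on the
sphere of radius `√D` the value is `√D ^ d` times that of `p` at the normalized vector. -/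
def juntaPoly {D n : ℕ} (M : Fin D → Fin n → ℝ) (d : ℕ) (p : MvPolynomial (Fin n) ℝ) :
    MvPolynomial (Fin D) ℝ :=
  weightedAeval d p (fun e => (∑ l, X l ^ 2) ^ (e / 2) * C (Real.sqrt D) ^ (e % 2))
    fun i => ∑ l, C (M l i) * X l

lemma totalDegree_juntaPoly_le {D n d : ℕ} (M : Fin D → Fin n → ℝ) {p : MvPolynomial (Fin n) ℝ}
    (hp : p.totalDegree ≤ d) : (juntaPoly M d p).totalDegree ≤ d := by
  refine totalDegree_weightedAeval_le hp (fun e => ?_) fun i => ?_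
  · have h2 : (∑ l : Fin D, (X l : MvPolynomial (Fin D) ℝ) ^ 2).totalDegree ≤ 2 :=
      totalDegree_finsetSum_le fun l _ => by
        refine (totalDegree_pow _ _).trans ?_
        simp
    have h0 : (C (Real.sqrt D) ^ (e % 2) : MvPolynomial (Fin D) ℝ).totalDegree = 0 := by
      rw [← C_pow]
      exact totalDegree_C _
    have h := (totalDegree_pow (∑ l : Fin D, (X l : MvPolynomial (Fin D) ℝ) ^ 2) (e / 2)).trans
      (Nat.mul_le_mul_left _ h2)
    have h' := totalDegree_mul ((∑ l : Fin D, (X l : MvPolynomial (Fin D) ℝ) ^ 2) ^ (e / 2))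
      (C (Real.sqrt D) ^ (e % 2))
    omega
  · refine totalDegree_finsetSum_le fun l _ => (totalDegree_mul _ _).trans ?_
    simp

lemma eval_juntaPoly {D n d : ℕ} (M : Fin D → Fin n → ℝ) (p : MvPolynomial (Fin n) ℝ)
    (a : Fin D → ℝ) :
    eval a (juntaPoly M d p) =
      weightedAeval d p (fun e => (∑ l, a l ^ 2) ^ (e / 2) * Real.sqrt D ^ (e % 2))
        (comb a M) := by
  rw [← MvPolynomial.aeval_eq_eval, juntaPoly, map_weightedAeval]
  congr 1
  · funext e
    simp
  · funext i
    simp [comb, mul_comm]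

lemma continuous_eval_juntaPoly {D n d : ℕ} (p : MvPolynomial (Fin n) ℝ) :
    Continuous fun q : (Fin D → Fin n → ℝ) × (Fin D → ℝ) => eval q.2 (juntaPoly q.1 d p) := by
  simp only [eval_juntaPoly, weightedAeval]
  have h (i : Fin n) : Continuous fun q : (Fin D → Fin n → ℝ) × (Fin D → ℝ) =>
      comb q.2 q.1 i :=
    (continuous_apply i).comp (continuous_comb.comp continuous_swap)
  fun_prop

/-- The multivariate PTF on `ℝᴰ` obtained by restricting `PTF(p₁,…,p_k)` to the span of the
rows of `M`. -/
def juntaPtf {D n k : ℕ} [NeZero k] (d : ℕ) (p : Fin k → MvPolynomial (Fin n) ℝ)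
    (M : Fin D → Fin n → ℝ) : (Fin D → ℝ) → Fin k :=
  ptf fun j => juntaPoly M d (p j)

lemma measurable_juntaPtf {D n k d : ℕ} [NeZero k] (p : Fin k → MvPolynomial (Fin n) ℝ) :
    Measurable fun q : (Fin D → Fin n → ℝ) × (Fin D → ℝ) => juntaPtf d p q.1 q.2 :=
  measurable_ptfSel.comp
    (measurable_pi_lambda _ fun j => (continuous_eval_juntaPoly (p j)).measurable)

lemma pos_perturb_iff {η c x y s : ℝ} (hc : 0 ≤ c) (hη : |1 - c| ≤ η * (1 + c)) (hs : |s| ≤ 1)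
    (h : ¬(|x| ≤ η * |y| ∧ y ≠ 0)) :
    0 < (1 + c) / 2 * x + (1 - c) / 2 * (s * y) ↔ 0 < x := by
  rcases eq_or_ne y 0 with rfl | hy
  · simp only [mul_zero, add_zero]
    exact mul_pos_iff_of_pos_left (by linarith)
  · have hxy : η * |y| < |x| := not_le.mp fun hle => h ⟨hle, hy⟩
    have hsmall : |(1 - c) * (s * y)| < (1 + c) * |x| := by
      rw [abs_mul, abs_mul]
      have h1 : |s| * |y| ≤ 1 * |y| := by gcongr
      calc |1 - c| * (|s| * |y|) ≤ (η * (1 + c)) * (1 * |y|) := by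
            gcongr
            exact (abs_nonneg _).trans hη
        _ = (1 + c) * (η * |y|) := by ring
        _ < (1 + c) * |x| := by gcongr
    obtain ⟨hl, hr⟩ := abs_lt.mp hsmall
    constructor
    · intro hpos
      by_contra hx
      rw [abs_of_nonpos (not_lt.mp hx)] at hr
      linarith
    · intro hx
      rw [abs_of_pos hx] at hl
      linarith

lemma sum_normalize_sq {D : ℕ} {a : Fin D → ℝ} (ha : 0 < ∑ l, a l ^ 2) :
    ∑ l, (a l / Real.sqrt (∑ i, a i ^ 2)) ^ 2 = 1 := by
  simp only [div_pow, ← Finset.sum_div, Real.sq_sqrt ha.le]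
  exact div_self ha.ne'

lemma sum_normalize_mul {D : ℕ} (a b : Fin D → ℝ) :
    ∑ l, a l / Real.sqrt (∑ i, a i ^ 2) * (b l / Real.sqrt (∑ i, b i ^ 2)) = cosAngle a b := by
  simp only [div_mul_div_comm, ← Finset.sum_div]
  rfl

/-- The normalized combination `∑ l, (a l / ‖a‖) • M l`. -/
def unitComb {D n : ℕ} (a : Fin D → ℝ) (M : Fin D → Fin n → ℝ) : Fin n → ℝ :=
  comb (fun l => a l / Real.sqrt (∑ i, a i ^ 2)) M

lemma juntaPtf_eq {D n k d : ℕ} [NeZero k] {p : Fin k → MvPolynomial (Fin n) ℝ}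
    (hp : ∀ j, (p j).totalDegree ≤ d) {η : ℝ} {a : Fin D → ℝ} (ha : a ∈ nearSphere D η)
    {M : Fin D → Fin n → ℝ} (hM : ∀ j, unitComb a M ∉ antipodalSmall η (p j)) :
    juntaPtf d p M a = ptf p (unitComb a M) := by
  obtain ⟨hA, hnear⟩ := ha
  set r := Real.sqrt (∑ l, a l ^ 2) with hr
  have hr0 : 0 < r := Real.sqrt_pos.mpr hA
  have hr2 : r ^ 2 = ∑ l, a l ^ 2 := Real.sq_sqrt hA.le
  rw [juntaPtf, ptf_eq_ptfSel, ptf_eq_ptfSel]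
  refine ptfSel_congr fun j => ?_
  have hcr : Real.sqrt D / r * r = Real.sqrt D := div_mul_cancel₀ _ hr0.ne'
  have hcomb : comb a M = fun i => r * unitComb a M i := by
    funext i
    simp only [unitComb, comb, Finset.sum_apply, Pi.smul_apply, smul_eq_mul, Finset.mul_sum]
    refine Finset.sum_congr rfl fun l _ => ?_
    rw [← hr]
    field_simp
  rw [eval_juntaPoly, ← hr2, hcomb, ← hcr, weightedAeval_parity (hp j),
    mul_pos_iff_of_pos_left (pow_pos hr0 d)]
  refine pos_perturb_iff (η := η) (by positivity) ?_ (by simp) (hM j)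
  have h1 : 1 - Real.sqrt D / r = (r - Real.sqrt D) / r := by field_simp
  have h2 : 1 + Real.sqrt D / r = (r + Real.sqrt D) / r := by field_simp
  rw [h1, h2, abs_div, abs_of_pos hr0, ← mul_div_assoc]
  gcongr

/-- The matrices `M` for which the normalized combination of the rows with coefficients `a`
falls into one of the sets `antipodalSmall η (p j)`. -/
def badRows {D n k : ℕ} (η : ℝ) (p : Fin k → MvPolynomial (Fin n) ℝ) (a : Fin D → ℝ) :
    Set (Fin D → Fin n → ℝ) :=
  ⋃ j, unitComb a ⁻¹' antipodalSmall η (p j)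

lemma measure_badRows_le {D n k : ℕ} {η δ : ℝ} {p : Fin k → MvPolynomial (Fin n) ℝ}
    (hη : ∀ j, (gaussianPi (Fin n)).real (antipodalSmall η (p j)) ≤ δ) {a : Fin D → ℝ}
    (ha : a ∈ nearSphere D η) :
    (gaussianFam (Fin D) n).real (badRows η p a) ≤ k * δ := by
  have hsum : ∑ _j : Fin k, δ = k * δ := by simp
  rw [← hsum]
  refine (measureReal_iUnion_fintype_le _).trans (Finset.sum_le_sum fun j _ => ?_)
  refine le_trans (le_of_eq ?_) (hη j)
  rw [← map_comb (sum_normalize_sq ha.1),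
    map_measureReal_apply (measurable_comb _) (measurableSet_antipodalSmall η (p j))]
  rfl

lemma abs_measure_juntaPtf_sub_le {D n k d : ℕ} [NeZero k] {η δ : ℝ}
    {p : Fin k → MvPolynomial (Fin n) ℝ} (hp : ∀ j, (p j).totalDegree ≤ d)
    (hη : ∀ j, (gaussianPi (Fin n)).real (antipodalSmall η (p j)) ≤ δ) {a : Fin D → ℝ}
    (ha : a ∈ nearSphere D η) (j : Fin k) :
    |(gaussianFam (Fin D) n).real {M | juntaPtf d p M a = j} - gMean (ptf p) j| ≤ k * δ := by
  rw [gMean_eq (measurable_ptf p), ← map_comb (sum_normalize_sq ha.1),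
    map_measureReal_apply (measurable_comb _)
      (measurable_ptf p (measurableSet_singleton j))]
  have hgood : ∀ M ∉ badRows η p a, juntaPtf d p M a = ptf p (unitComb a M) := fun M hM =>
    juntaPtf_eq hp ha fun j hj => hM (Set.mem_iUnion.mpr ⟨j, hj⟩)
  refine (abs_measureReal_sub_le (E := badRows η p a) (fun M hM => ?_) fun M hM => ?_).trans
    (measure_badRows_le hη ha)
  · by_cases hb : M ∈ badRows η p a
    · exact Or.inr hb
    · exact Or.inl ((hgood M hb).symm.trans hM)
  · by_cases hb : M ∈ badRows η p a
    · exact Or.inr hb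
    · exact Or.inl ((hgood M hb).trans hM)

lemma abs_measure_juntaPtf_agree_sub_le {D n k d : ℕ} [NeZero k] {η δ : ℝ}
    {p : Fin k → MvPolynomial (Fin n) ℝ} (hp : ∀ j, (p j).totalDegree ≤ d)
    (hη : ∀ j, (gaussianPi (Fin n)).real (antipodalSmall η (p j)) ≤ δ) {a b : Fin D → ℝ}
    (ha : a ∈ nearSphere D η) (hb : b ∈ nearSphere D η) :
    |(gaussianFam (Fin D) n).real {M | juntaPtf d p M a = juntaPtf d p M b} -
      agreeProb (ptf p) (Real.arccos (cosAngle a b))| ≤ 2 * k * δ := by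
  have habs := abs_le.mp (abs_cosAngle_le_one a b)
  have hcos : Real.cos (0 - Real.arccos (cosAngle a b)) = cosAngle a b := by
    rw [zero_sub, Real.cos_neg, Real.cos_arccos habs.1 habs.2]
  rw [agreeProb, pairLaw, ← map_comb_eq_map_circ (sum_normalize_sq ha.1)
      (sum_normalize_sq hb.1) ((sum_normalize_mul a b).trans hcos.symm),
    map_measureReal_apply (measurable_comb_pair _ _)
      (measurableSet_agree (measurable_ptf p) (measurable_ptf p))]
  have hgood : ∀ M ∉ badRows η p a ∪ badRows η p b,
      juntaPtf d p M a = ptf p (unitComb a M) ∧ juntaPtf d p M b = ptf p (unitComb b M) :=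
    fun M hM => ⟨juntaPtf_eq hp ha fun j hj => hM (Or.inl (Set.mem_iUnion.mpr ⟨j, hj⟩)),
      juntaPtf_eq hp hb fun j hj => hM (Or.inr (Set.mem_iUnion.mpr ⟨j, hj⟩))⟩
  refine (abs_measureReal_sub_le (E := badRows η p a ∪ badRows η p b)
    (fun M hM => ?_) fun M hM => ?_).trans ?_
  · by_cases hbad : M ∈ badRows η p a ∪ badRows η p b
    · exact Or.inr hbad
    · exact Or.inl ((hgood M hbad).1.symm.trans (hM.trans (hgood M hbad).2))
  · by_cases hbad : M ∈ badRows η p a ∪ badRows η p b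
    · exact Or.inr hbad
    · exact Or.inl ((hgood M hbad).1.trans (Eq.trans hM (hgood M hbad).2.symm))
  · refine (measureReal_union_le _ _).trans ?_
    linarith [measure_badRows_le hη ha, measure_badRows_le hη hb]

lemma abs_integral_sub_le_of_good {Z : Type*} [MeasurableSpace Z] {ζ : Measure Z}
    [IsProbabilityMeasure ζ] {g : Z → ℝ} {G : Set Z} {c κ : ℝ} (hg : Integrable g ζ)
    (hG : MeasurableSet G) (hg1 : ∀ z, g z ∈ Set.Icc 0 1) (hc : c ∈ Set.Icc 0 1) (hκ : 0 ≤ κ)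
    (h : ∀ z ∈ G, |g z - c| ≤ κ) : |∫ z, g z ∂ζ - c| ≤ κ + ζ.real Gᶜ := by
  have hsub : ∫ z, g z ∂ζ - c = ∫ z, (g z - c) ∂ζ := by
    rw [integral_sub hg (integrable_const c)]
    simp
  have hI : Integrable (Gᶜ.indicator (1 : Z → ℝ)) ζ :=
    (integrable_const (1 : ℝ)).indicator hG.compl
  have hind : ∫ z, (κ + Gᶜ.indicator (1 : Z → ℝ) z) ∂ζ = κ + ζ.real Gᶜ := by
    rw [integral_add (integrable_const κ) hI, integral_indicator_one hG.compl]
    simp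
  rw [hsub, ← hind]
  refine (abs_integral_le_integral_abs).trans (integral_mono (hg.sub (integrable_const c)).abs
    ((integrable_const κ).add hI) fun z => ?_)
  by_cases hz : z ∈ G
  · simpa [hz] using h z hz
  · have h1 := hg1 z
    have habs : |g z - c| ≤ 1 :=
      abs_le.mpr ⟨by linarith [h1.1, hc.2], by linarith [h1.2, hc.1]⟩
    simp only [Set.indicator_of_mem (Set.mem_compl hz), Pi.one_apply]
    linarith

lemma measurable_juntaPtf_apply {D n k d : ℕ} [NeZero k] (p : Fin k → MvPolynomial (Fin n) ℝ)
    (M : Fin D → Fin n → ℝ) : Measurable (juntaPtf d p M) :=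
  measurable_ptf _

section Average

variable {D n k d : ℕ} [NeZero k] {η η' δ θ : ℝ} {p : Fin k → MvPolynomial (Fin n) ℝ}

lemma measurableSet_juntaPtf_agree (α : ℝ) :
    MeasurableSet {q : (Fin D → Fin n → ℝ) × ((Fin D → ℝ) × (Fin D → ℝ)) |
      juntaPtf d p q.1 q.2.1 = juntaPtf d p q.1 (circ α q.2)} := by
  have h1 : Measurable fun q : (Fin D → Fin n → ℝ) × ((Fin D → ℝ) × (Fin D → ℝ)) =>
      (q.1, q.2.1) := measurable_fst.prodMk (measurable_fst.comp measurable_snd)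
  have h2 : Measurable fun q : (Fin D → Fin n → ℝ) × ((Fin D → ℝ) × (Fin D → ℝ)) =>
      (q.1, circ α q.2) := measurable_fst.prodMk ((measurable_circ α).comp measurable_snd)
  have h1' := (measurable_juntaPtf (d := d) p).comp h1
  have h2' := (measurable_juntaPtf (d := d) p).comp h2
  exact measurableSet_eq_fun h1' h2'

lemma measurableSet_juntaPtf_eq (j : Fin k) :
    MeasurableSet {q : (Fin D → Fin n → ℝ) × (Fin D → ℝ) | juntaPtf d p q.1 q.2 = j} :=
  measurable_juntaPtf p (measurableSet_singleton j)

lemma integrable_agreeProb_juntaPtf (α : ℝ) :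
    Integrable (fun M => agreeProb (juntaPtf d p M) α) (gaussianFam (Fin D) n) := by
  have h := (integral_measureReal_swap (μ := gaussianFam (Fin D) n) (ζ := gaussianPair D)
    (measurableSet_juntaPtf_agree (d := d) (p := p) α)).1
  simp only [agreeProb_eq (measurable_juntaPtf_apply p _)]
  exact h

lemma integrable_gMean_juntaPtf (j : Fin k) :
    Integrable (fun M => gMean (juntaPtf d p M) j) (gaussianFam (Fin D) n) := by
  have h := (integral_measureReal_swap (μ := gaussianFam (Fin D) n) (ζ := gaussianPi (Fin D))
    (measurableSet_juntaPtf_eq (d := d) (p := p) j)).1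
  simp only [gMean_eq (measurable_juntaPtf_apply p _)]
  exact h

lemma abs_integral_agreeProb_juntaPtf_sub_le (hp : ∀ j, (p j).totalDegree ≤ d) (hδ : 0 ≤ δ)
    (hη : ∀ j, (gaussianPi (Fin n)).real (antipodalSmall η (p j)) ≤ δ)
    (hθ : ∀ ψ ψ', |ψ - ψ'| ≤ θ → |agreeProb (ptf p) ψ - agreeProb (ptf p) ψ'| ≤ δ)
    {α : ℝ} (hgood : ∀ z ∈ goodPairs D η', z.1 ∈ nearSphere D η ∧ circ α z ∈ nearSphere D η ∧
      |Real.arccos (cosAngle z.1 (circ α z)) - α| ≤ θ)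
    (hmeas : (gaussianPair D).real (goodPairs D η')ᶜ ≤ δ) :
    |∫ M, agreeProb (juntaPtf d p M) α ∂gaussianFam (Fin D) n - agreeProb (ptf p) α| ≤
      (2 * k + 2) * δ := by
  obtain ⟨-, hint, hswap⟩ := integral_measureReal_swap (μ := gaussianFam (Fin D) n)
    (ζ := gaussianPair D) (measurableSet_juntaPtf_agree (d := d) (p := p) α)
  have heq : ∫ M, agreeProb (juntaPtf d p M) α ∂gaussianFam (Fin D) n =
      ∫ z, (gaussianFam (Fin D) n).real
        {M | juntaPtf d p M z.1 = juntaPtf d p M (circ α z)} ∂gaussianPair D := by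
    simp only [agreeProb_eq (measurable_juntaPtf_apply p _)]
    exact hswap
  have hle : 2 * k * δ + δ + (gaussianPair D).real (goodPairs D η')ᶜ ≤ (2 * k + 2) * δ := by
    linarith only [hmeas]
  have hclose : ∀ z ∈ goodPairs D η', |(gaussianFam (Fin D) n).real
      {M | juntaPtf d p M z.1 = juntaPtf d p M (circ α z)} - agreeProb (ptf p) α| ≤
        2 * k * δ + δ := fun z hz => by
    obtain ⟨h1, h2, h3⟩ := hgood z hz
    exact (abs_sub_le _ _ _).trans
      (add_le_add (abs_measure_juntaPtf_agree_sub_le hp hη h1 h2) (hθ _ _ h3))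
  have hfar := abs_integral_sub_le_of_good hint (measurableSet_goodPairs D η')
    (fun z => ⟨measureReal_nonneg, measureReal_le_one⟩)
    ⟨measureReal_nonneg, measureReal_le_one⟩ (by positivity) hclose
  rw [heq]
  exact hfar.trans hle

lemma abs_integral_gMean_juntaPtf_sub_le (hp : ∀ j, (p j).totalDegree ≤ d) (hδ : 0 ≤ δ)
    (hη : ∀ j, (gaussianPi (Fin n)).real (antipodalSmall η (p j)) ≤ δ)
    (hgood : ∀ z ∈ goodPairs D η', z.1 ∈ nearSphere D η)
    (hmeas : (gaussianPair D).real (goodPairs D η')ᶜ ≤ δ) (j : Fin k) :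
    |∫ M, gMean (juntaPtf d p M) j ∂gaussianFam (Fin D) n - gMean (ptf p) j| ≤
      (k + 1) * δ := by
  have hE : MeasurableSet {q : (Fin D → Fin n → ℝ) × ((Fin D → ℝ) × (Fin D → ℝ)) |
      juntaPtf d p q.1 q.2.1 = j} :=
    ((measurable_juntaPtf p).comp (measurable_fst.prodMk (measurable_fst.comp measurable_snd)))
      (measurableSet_singleton j)
  obtain ⟨-, hint, hswap⟩ := integral_measureReal_swap (μ := gaussianFam (Fin D) n)
    (ζ := gaussianPair D) hE
  have hfst : ∀ M : Fin D → Fin n → ℝ, gMean (juntaPtf d p M) j =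
      (gaussianPair D).real {z | juntaPtf d p M z.1 = j} := fun M => by
    have hprod : {z : (Fin D → ℝ) × (Fin D → ℝ) | juntaPtf d p M z.1 = j} =
        (juntaPtf d p M ⁻¹' {j}) ×ˢ Set.univ := by
      ext z
      simp
    rw [hprod, gaussianPair, measureReal_prod_prod, gMean_eq (measurable_juntaPtf_apply p M)]
    simp
  have heq : ∫ M, gMean (juntaPtf d p M) j ∂gaussianFam (Fin D) n =
      ∫ z, (gaussianFam (Fin D) n).real {M | juntaPtf d p M z.1 = j} ∂gaussianPair D := by
    simp only [hfst]
    exact hswap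
  have hmean := gMean_eq (measurable_ptf p) j
  rw [heq]
  refine (abs_integral_sub_le_of_good (κ := k * δ) hint (measurableSet_goodPairs D η')
    (fun z => ⟨measureReal_nonneg, measureReal_le_one⟩)
    ⟨hmean ▸ measureReal_nonneg, hmean ▸ measureReal_le_one⟩
    (by positivity) fun z hz => ?_).trans (by linarith)
  exact abs_measure_juntaPtf_sub_le hp hη (hgood z hz) j

/-- The squared distance of the mean vectors is small on average. -/
lemma integral_sum_gMean_sub_sq_le
    (hagree : |∫ M, agreeProb (juntaPtf d p M) (Real.pi / 2) ∂gaussianFam (Fin D) n -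
      agreeProb (ptf p) (Real.pi / 2)| ≤ (2 * k + 2) * δ)
    (hmean : ∀ j, |∫ M, gMean (juntaPtf d p M) j ∂gaussianFam (Fin D) n - gMean (ptf p) j| ≤
      (k + 1) * δ) :
    Integrable (fun M => ∑ j, (gMean (juntaPtf d p M) j - gMean (ptf p) j) ^ 2)
        (gaussianFam (Fin D) n) ∧
      ∫ M, ∑ j, (gMean (juntaPtf d p M) j - gMean (ptf p) j) ^ 2 ∂gaussianFam (Fin D) n ≤
        (4 * k + 4) * δ := by
  have hexpand : (fun M : Fin D → Fin n → ℝ =>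
      ∑ j, (gMean (juntaPtf d p M) j - gMean (ptf p) j) ^ 2) = fun M =>
      agreeProb (juntaPtf d p M) (Real.pi / 2) -
        ∑ j, 2 * gMean (ptf p) j * gMean (juntaPtf d p M) j + agreeProb (ptf p) (Real.pi / 2) := by
    funext M
    rw [agreeProb_pi_div_two (measurable_juntaPtf_apply p M),
      agreeProb_pi_div_two (measurable_ptf p), ← Finset.sum_sub_distrib,
      ← Finset.sum_add_distrib]
    exact Finset.sum_congr rfl fun j _ => by ring
  have hI1 := integrable_agreeProb_juntaPtf (D := D) (d := d) (p := p) (Real.pi / 2)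
  have hI2 : ∀ j ∈ Finset.univ, Integrable (fun M : Fin D → Fin n → ℝ =>
      2 * gMean (ptf p) j * gMean (juntaPtf d p M) j) (gaussianFam (Fin D) n) := fun j _ =>
    (integrable_gMean_juntaPtf j).const_mul _
  have hI3 := integrable_finsetSum Finset.univ hI2
  have hI4 : Integrable (fun M : Fin D → Fin n → ℝ => agreeProb (juntaPtf d p M) (Real.pi / 2) -
      ∑ j, 2 * gMean (ptf p) j * gMean (juntaPtf d p M) j) (gaussianFam (Fin D) n) := hI1.sub hI3
  rw [hexpand]
  refine ⟨hI4.add (integrable_const _), ?_⟩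
  rw [integral_add hI4 (integrable_const _), integral_sub hI1 hI3,
    integral_finsetSum _ hI2]
  simp only [integral_const_mul, integral_const, probReal_univ, one_smul]
  have hcross : ∑ j, 2 * gMean (ptf p) j *
      (gMean (ptf p) j - ∫ M, gMean (juntaPtf d p M) j ∂gaussianFam (Fin D) n) ≤
      2 * ((k + 1) * δ) := by
    calc _ ≤ ∑ j, 2 * gMean (ptf p) j * ((k + 1) * δ) := by
          refine Finset.sum_le_sum fun j _ => mul_le_mul_of_nonneg_left ?_
            (mul_nonneg zero_le_two (gMean_nonneg (measurable_ptf p) j))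
          linarith [(abs_le.mp (hmean j)).1]
      _ = 2 * ((k + 1) * δ) := by
          rw [← Finset.sum_mul, ← Finset.mul_sum, sum_gMean (measurable_ptf p), mul_one]
  have hsq : ∑ j, 2 * gMean (ptf p) j *
      (gMean (ptf p) j - ∫ M, gMean (juntaPtf d p M) j ∂gaussianFam (Fin D) n) =
      2 * agreeProb (ptf p) (Real.pi / 2) - ∑ j, 2 * gMean (ptf p) j *
        ∫ M, gMean (juntaPtf d p M) j ∂gaussianFam (Fin D) n := by
    rw [agreeProb_pi_div_two (measurable_ptf p), Finset.mul_sum, ← Finset.sum_sub_distrib]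
    exact Finset.sum_congr rfl fun j _ => by ring
  linarith [(abs_le.mp hagree).2]

end Average

lemma sum_abs_le_of_sum_sq_le {k : ℕ} [NeZero k] {ε : ℝ} (hε : 0 < ε) {v : Fin k → ℝ}
    (h : ∑ j, v j ^ 2 ≤ ε ^ 2 / k) : ∑ j, |v j| ≤ ε := by
  have hk : (0 : ℝ) < k := by exact_mod_cast Nat.pos_of_ne_zero (NeZero.ne k)
  refine abs_le_of_sq_le_sq' ?_ hε.le |>.2
  have hcs := sq_sum_le_card_mul_sum_sq (s := Finset.univ) (f := fun j => |v j|)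
  simp only [sq_abs, Finset.card_univ, Fintype.card_fin] at hcs
  refine hcs.trans ?_
  rw [le_div_iff₀ hk] at h
  linarith

end GaussNS

/-- For `t, ε > 0` there is `n₀ = n₀(d, k, ε)` such that every
degree-`d`, `(d,ε)`-balanced multivariate PTF `f : ℝⁿ → [k]` with
`Pr[Collision(f)] ≤ ε/(40k²)` admits a degree-`d` multivariate PTF on `ℝ^{n₀}` with
`‖E[f_junta] - E[f]‖₁ ≤ ε` and `E⟨f_junta, P_t f_junta⟩ ≥ E⟨f, P_t f⟩ - ε`. -/
theorem stmt11 (k d : ℕ) [NeZero k] (ε : ℝ) (hε : 0 < ε) :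
    ∃ n₀ : ℕ, ∀ t : ℝ, 0 < t → ∀ (n : ℕ) (p : Fin k → MvPolynomial (Fin n) ℝ),
      (∀ i, (p i).totalDegree ≤ d) → balancedFam d ε p →
      ((gaussianPi (Fin n)) (collisionSet p)).toReal ≤ ε / (40 * k ^ 2) →
      ∃ q : Fin k → MvPolynomial (Fin n₀) ℝ,
        (∀ i, (q i).totalDegree ≤ d) ∧
        (∑ j, |gMean (ptf q) j - gMean (ptf p) j|) ≤ ε ∧
        noiseStab t (ptf q) ≥ noiseStab t (ptf p) - ε := by
  have hk : (0 : ℝ) < k := by exact_mod_cast Nat.pos_of_ne_zero (NeZero.ne k)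
  set lam : ℝ := 2 * k / ε ^ 2 with hlam
  have hlam0 : 0 < lam := by positivity
  set δ : ℝ := min ε 1 / (lam * (4 * k + 4) + (2 * k + 2)) with hδdef
  have hden : 0 < lam * (4 * k + 4) + (2 * k + 2) := by positivity
  have hδ : 0 < δ := div_pos (lt_min hε one_pos) hden
  have hδmul : (lam * (4 * k + 4) + (2 * k + 2)) * δ = min ε 1 := mul_div_cancel₀ _ hden.ne'
  clear_value δ
  obtain ⟨η, hη, hanti⟩ := exists_antipodalSmall_le d hδ
  obtain ⟨θ, hθ, hmod⟩ := exists_agreeProb_modulus d k hδ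
  obtain ⟨η', hη', hangle⟩ := exists_goodPairs_angle hη hθ
  obtain ⟨D, hD, hgood⟩ := exists_goodPairs hη' hδ
  refine ⟨D, fun t ht n p hp _ _ => ?_⟩
  set α := Real.arccos (Real.exp (-t)) with hα
  have hαmem : α ∈ Set.Icc 0 (Real.pi / 2) :=
    ⟨Real.arccos_nonneg _, Real.arccos_le_pi_div_two.mpr (Real.exp_pos _).le⟩
  have hagree : ∀ β ∈ Set.Icc 0 (Real.pi / 2),
      |∫ M, agreeProb (juntaPtf d p M) β ∂gaussianFam (Fin D) n - agreeProb (ptf p) β| ≤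
        (2 * k + 2) * δ := fun β hβ =>
    abs_integral_agreeProb_juntaPtf_sub_le hp hδ.le (fun j => hanti n (p j) (hp j))
      (fun ψ ψ' h => hmod n p hp ψ ψ' h) (fun z hz => hangle D hD z hz β hβ) hgood
  have hmean := abs_integral_gMean_juntaPtf_sub_le hp hδ.le (fun j => hanti n (p j) (hp j))
    (fun z hz => (hangle D hD z hz α hαmem).1) hgood
  obtain ⟨hVint, hV⟩ := integral_sum_gMean_sub_sq_le
    (hagree _ ⟨by positivity, le_rfl⟩) hmean
  have hSint : Integrable (fun M => agreeProb (ptf p) α - agreeProb (juntaPtf d p M) α)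
      (gaussianFam (Fin D) n) := (integrable_const _).sub (integrable_agreeProb_juntaPtf α)
  obtain ⟨M, hM⟩ := exists_le_integral ((hVint.const_mul lam).add hSint)
  have hbound : lam * ∑ j, (gMean (juntaPtf d p M) j - gMean (ptf p) j) ^ 2 +
      (agreeProb (ptf p) α - agreeProb (juntaPtf d p M) α) ≤ min ε 1 := by
    refine hM.trans ?_
    simp only [Pi.add_apply]
    rw [integral_add (hVint.const_mul lam) hSint, integral_const_mul,
      integral_sub (integrable_const _) (integrable_agreeProb_juntaPtf α), ← hδmul]
    simp only [integral_const, probReal_univ, one_smul]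
    have h1 := mul_le_mul_of_nonneg_left hV hlam0.le
    linarith [(abs_le.mp (hagree α hαmem)).1]
  set V := ∑ j, (gMean (juntaPtf d p M) j - gMean (ptf p) j) ^ 2 with hVdef
  have hV0 : 0 ≤ V := Finset.sum_nonneg fun j _ => sq_nonneg _
  have hq : agreeProb (juntaPtf d p M) α ≤ 1 := measureReal_le_one
  have hf : 0 ≤ agreeProb (ptf p) α := measureReal_nonneg
  refine ⟨fun j => juntaPoly M d (p j), fun j => totalDegree_juntaPoly_le M (hp j), ?_, ?_⟩
  · refine sum_abs_le_of_sum_sq_le hε ?_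
    change V ≤ ε ^ 2 / k
    have hlamV : lam * V ≤ 2 := by linarith [min_le_right ε 1]
    rw [hlam, div_mul_eq_mul_div, div_le_iff₀ (by positivity)] at hlamV
    rw [le_div_iff₀ hk]
    linarith
  · rw [noiseStab_eq (measurable_ptf _) t ht, noiseStab_eq (measurable_ptf p) t ht]
    have := mul_nonneg hlam0.le hV0
    change agreeProb (juntaPtf d p M) α ≥ agreeProb (ptf p) α - ε
    linarith [min_le_left ε 1]
end
end

section
/- Let f be a symmetric d-tensor over ℝⁿ with λ_max(f) ≤ κ, let g ∈ (ℝⁿ)^{⊗d'} be any tensor, and let 0 < r ≤ min{d−1, d'}. Then ‖f ⊗_r g‖_F ≤ κ·‖g‖_F. -/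
open MeasureTheory ProbabilityTheory MvPolynomial
open scoped Classical

noncomputable section

open GaussNS

namespace GaussNS

variable {α β ι : Type*} [Fintype α] [Fintype β] [Fintype ι]

lemma frobNorm_nonneg (T : (α → ι) → ℝ) : 0 ≤ frobNorm T := Real.sqrt_nonneg _

lemma frobNorm_sq [DecidableEq α] (T : (α → ι) → ℝ) : frobNorm T ^ 2 = ∑ t, T t ^ 2 := by
  rw [frobNorm, Real.sq_sqrt (Finset.sum_nonneg fun _ _ => sq_nonneg _)]
  congr!

lemma abs_le_frobNorm (T : (α → ι) → ℝ) (t : α → ι) : |T t| ≤ frobNorm T :=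
  Real.abs_le_sqrt (Finset.single_le_sum (f := fun t => T t ^ 2)
    (fun _ _ => sq_nonneg _) (Finset.mem_univ t))

/-- The Frobenius norm is invariant under relabelling the modes of a tensor. -/
lemma frobNorm_comp_equiv (e : α ≃ β) (T : (α → ι) → ℝ) :
    frobNorm (fun t : β → ι => T (fun a => t (e a))) = frobNorm T := by
  unfold frobNorm
  congr 1
  exact Fintype.sum_equiv (Equiv.arrowCongr e.symm (Equiv.refl ι)) _ _ fun _ => rfl

variable {q : ℕ} (A : (Fin q → ι) → ℝ) (S : Finset (Fin q))

/-- The pairing of `A` with `g ⊗ h` is at most `‖A‖₁ ‖g‖ ‖h‖`. -/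
lemma abs_pairing_le (g : ({i // i ∈ S} → ι) → ℝ) (h : ({i // i ∉ S} → ι) → ℝ) :
    |∑ t : Fin q → ι, A t * g (fun i => t i.1) * h (fun i => t i.1)| ≤
      (∑ t, |A t|) * (frobNorm g * frobNorm h) := by
  rw [Finset.sum_mul]
  refine (Finset.abs_sum_le_sum_abs _ _).trans (Finset.sum_le_sum fun t _ => ?_)
  rw [abs_mul, abs_mul, mul_assoc]
  have := frobNorm_nonneg g
  gcongr <;> exact abs_le_frobNorm _ _

lemma pairing_div_le (g : ({i // i ∈ S} → ι) → ℝ) (h : ({i // i ∉ S} → ι) → ℝ) :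
    (∑ t : Fin q → ι, A t * g (fun i => t i.1) * h (fun i => t i.1)) /
      (frobNorm g * frobNorm h) ≤ ∑ t, |A t| :=
  div_le_of_le_mul₀ (mul_nonneg (frobNorm_nonneg g) (frobNorm_nonneg h))
    (Finset.sum_nonneg fun _ _ => abs_nonneg _) ((le_abs_self _).trans (abs_pairing_le A S g h))

lemma pairing_div_le_lamPart (g : ({i // i ∈ S} → ι) → ℝ) (h : ({i // i ∉ S} → ι) → ℝ) :
    (∑ t : Fin q → ι, A t * g (fun i => t i.1) * h (fun i => t i.1)) /
      (frobNorm g * frobNorm h) ≤ lamPart A S :=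
  le_ciSup_of_le
    ⟨∑ t, |A t|, by rintro _ ⟨g, rfl⟩; exact ciSup_le fun h => pairing_div_le A S g h⟩ g
    (le_ciSup (f := fun h : ({i // i ∉ S} → ι) → ℝ =>
      (∑ t : Fin q → ι, A t * g (fun i => t i.1) * h (fun i => t i.1)) /
        (frobNorm g * frobNorm h))
      ⟨∑ t, |A t|, by rintro _ ⟨h, rfl⟩; exact pairing_div_le A S g h⟩ h)

lemma pairing_le_lamPart (g : ({i // i ∈ S} → ι) → ℝ) (h : ({i // i ∉ S} → ι) → ℝ) :
    ∑ t : Fin q → ι, A t * g (fun i => t i.1) * h (fun i => t i.1) ≤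
      lamPart A S * (frobNorm g * frobNorm h) := by
  rcases (mul_nonneg (frobNorm_nonneg g) (frobNorm_nonneg h)).eq_or_lt with h0 | h0
  · have := abs_pairing_le A S g h
    rw [← h0, mul_zero] at this ⊢
    exact (le_abs_self _).trans this
  · exact (div_le_iff₀ h0).1 (pairing_div_le_lamPart A S g h)

lemma lamPart_nonneg : 0 ≤ lamPart A S := by
  simpa using pairing_div_le_lamPart A S 0 0

lemma lamMax_nonneg : 0 ≤ lamMax A := Real.iSup_nonneg fun S => lamPart_nonneg A S.1

variable {A S}

lemma lamPart_le_lamMax (h₁ : S ≠ ∅) (h₂ : S ≠ Finset.univ) : lamPart A S ≤ lamMax A :=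
  le_ciSup (f := fun S : {S : Finset (Fin q) // S ≠ ∅ ∧ S ≠ Finset.univ} => lamPart A S.1)
    (Set.finite_range _).bddAbove ⟨S, h₁, h₂⟩

/-- `λ_max` bounds the bilinear form of every matricization of `A`, where the matricization is
given by splitting the modes as a disjoint sum. -/
lemma sum_sum_le_lamMax [DecidableEq α] [DecidableEq β] [Nonempty α] [Nonempty β]
    (A : (Fin q → ι) → ℝ) (e : α ⊕ β ≃ Fin q) (u : (α → ι) → ℝ)
    (v : (β → ι) → ℝ) :
    ∑ a : α → ι, ∑ b : β → ι, A (fun i => Sum.elim a b (e.symm i)) * u a * v b ≤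
      lamMax A * (frobNorm u * frobNorm v) := by
  let S : Finset (Fin q) := Finset.univ.filter fun i => (e.symm i).isLeft
  have memS (i : Fin q) : i ∈ S ↔ (e.symm i).isLeft := by simp [S]
  let eL : α ≃ {i // i ∈ S} := Equiv.ofBijective
    (fun a => ⟨e (Sum.inl a), by simp [memS]⟩)
    ⟨fun a b hab => by simpa using hab, fun ⟨i, hi⟩ => by
      obtain ⟨a, ha⟩ := Sum.isLeft_iff.1 ((memS i).1 hi)
      exact ⟨a, by simp [← ha]⟩⟩
  let eR : β ≃ {i // i ∉ S} := Equiv.ofBijective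
    (fun b => ⟨e (Sum.inr b), by simp [memS]⟩)
    ⟨fun a b hab => by simpa using hab, fun ⟨i, hi⟩ => by
      rw [memS, Bool.not_eq_true, Sum.isLeft_eq_false, Sum.isRight_iff] at hi
      obtain ⟨b, hb⟩ := hi
      exact ⟨b, by simp [← hb]⟩⟩
  have h₁ : S ≠ ∅ :=
    Finset.nonempty_iff_ne_empty.1 ⟨_, (eL (Classical.arbitrary α)).2⟩
  have h₂ : S ≠ Finset.univ := fun h =>
    (eR (Classical.arbitrary β)).2 (Finset.eq_univ_iff_forall.1 h _)
  have hL (a : α) : (eL a : Fin q) = e (Sum.inl a) := rfl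
  have hR (b : β) : (eR b : Fin q) = e (Sum.inr b) := rfl
  have key := (pairing_le_lamPart A S (fun x => u fun a => x (eL a))
    fun x => v fun b => x (eR b)).trans
    (mul_le_mul_of_nonneg_right (lamPart_le_lamMax h₁ h₂)
      (mul_nonneg (frobNorm_nonneg _) (frobNorm_nonneg _)))
  rw [frobNorm_comp_equiv eL, frobNorm_comp_equiv eR] at key
  refine le_of_eq_of_le ?_ key
  rw [← Fintype.sum_prod_type']
  refine Fintype.sum_equiv ((Equiv.sumArrowEquivProdArrow α β ι).symm.trans
    (Equiv.arrowCongr e (Equiv.refl ι))) _ _ fun x => ?_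
  simp [hL, hR, Equiv.sumArrowEquivProdArrow, Equiv.arrowCongr, Function.comp_def]

/-- Applying a matricization of `A` to a tensor increases its norm by a factor at most
`λ_max`. -/
lemma sum_sq_contraction_le [DecidableEq α] [DecidableEq β] [Nonempty α] [Nonempty β]
    (A : (Fin q → ι) → ℝ) (e : α ⊕ β ≃ Fin q) (v : (β → ι) → ℝ) :
    ∑ a : α → ι, (∑ b : β → ι, A (fun i => Sum.elim a b (e.symm i)) * v b) ^ 2 ≤
      lamMax A ^ 2 * ∑ b, v b ^ 2 := by
  let u : (α → ι) → ℝ := fun a => ∑ b : β → ι, A (fun i => Sum.elim a b (e.symm i)) * v b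
  have key : frobNorm u ^ 2 ≤ lamMax A * (frobNorm u * frobNorm v) := by
    refine le_of_eq_of_le ?_ (sum_sum_le_lamMax A e u v)
    rw [frobNorm_sq]
    refine Finset.sum_congr rfl fun a _ => ?_
    rw [sq]
    conv_lhs => enter [1]; simp only [u]
    rw [Finset.sum_mul]
    exact Finset.sum_congr rfl fun b _ => by ring
  have hle : frobNorm u ≤ lamMax A * frobNorm v := by
    rcases (frobNorm_nonneg u).eq_or_lt with h | h
    · rw [← h]; exact mul_nonneg (lamMax_nonneg A) (frobNorm_nonneg v)
    · exact le_of_mul_le_mul_left (by linarith) h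
  calc _ = frobNorm u ^ 2 := (frobNorm_sq u).symm
    _ ≤ (lamMax A * frobNorm v) ^ 2 := pow_le_pow_left₀ (frobNorm_nonneg u) hle 2
    _ = _ := by rw [mul_pow, frobNorm_sq]

/-- The splitting of `q` modes into the first `q - r` and the last `r`. -/
def splitLast {q r : ℕ} (h : r ≤ q) : Fin (q - r) ⊕ Fin r ≃ Fin q :=
  finSumFinEquiv.trans (finCongr (Nat.sub_add_cancel h))

lemma append_cast_eq_elim {q r : ℕ} {ι : Type*} (h : r ≤ q) (a : Fin (q - r) → ι)
    (z : Fin r → ι) (i : Fin q) :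
    Fin.append a z (Fin.cast (Nat.sub_add_cancel h).symm i) =
      Sum.elim a z ((splitLast h).symm i) := by
  obtain ⟨s, rfl⟩ := (splitLast h).surjective i
  rcases s with s | s <;> simp [splitLast]

end GaussNS

/-- If `f` is a symmetric `d`-tensor with `λ_max(f) ≤ κ`, `g` is any
`d'`-tensor and `0 < r ≤ min(d-1, d')`, then `‖f ⊗_r g‖_F ≤ κ ‖g‖_F`. -/
theorem stmt14 {n d d' r : ℕ} (κ : ℝ) (f : (Fin d → Fin n) → ℝ)
    (hsym : ∀ (σ : Equiv.Perm (Fin d)) (t : Fin d → Fin n), f (t ∘ σ) = f t)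
    (hκ : lamMax f ≤ κ)
    (g : (Fin d' → Fin n) → ℝ)
    (hr0 : 0 < r) (hr1 : r ≤ d - 1) (hr2 : r ≤ d') :
    Real.sqrt (∑ a, ∑ b, (contr (hr1.trans (Nat.sub_le d 1)) hr2 f g a b) ^ 2) ≤
      κ * frobNorm g := by
  have hd : Nonempty (Fin (d - r)) := ⟨⟨0, by omega⟩⟩
  have hr : Nonempty (Fin r) := ⟨⟨0, hr0⟩⟩
  refine le_trans (Real.sqrt_le_iff.2 ⟨mul_nonneg (lamMax_nonneg f) (frobNorm_nonneg g), ?_⟩)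
    (mul_le_mul_of_nonneg_right hκ (frobNorm_nonneg g))
  rw [Finset.sum_comm, mul_pow, frobNorm_sq]
  simp only [contr, append_cast_eq_elim (hr1.trans (Nat.sub_le d 1)), append_cast_eq_elim hr2]
  refine (Finset.sum_le_sum fun b _ => sum_sq_contraction_le f (splitLast _)
    fun z => g fun i => Sum.elim b z ((splitLast hr2).symm i)).trans_eq ?_
  rw [← Finset.mul_sum, ← Fintype.sum_prod_type' fun (b : Fin (d' - r) → Fin n)
    (z : Fin r → Fin n) => g (fun i => Sum.elim b z ((splitLast hr2).symm i)) ^ 2]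
  congr 1
  let e : (Fin (d' - r) → Fin n) × (Fin r → Fin n) ≃ (Fin d' → Fin n) :=
    (Equiv.sumArrowEquivProdArrow _ _ _).symm.trans
      (Equiv.arrowCongr (splitLast hr2) (Equiv.refl (Fin n)))
  exact Fintype.sum_equiv e _ _ fun x => rfl
end
end
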